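/- (Proposition 4.1) Rickman rugs have big vertical projections: for every M ≥ 1 there exists δ > 0 depending only on M such that if f : 𝕎 → ℍ is M-bilipschitz, then for every w ∈ 𝕎 and every r > 0 there exists θ ∈ [−π/2, π/2) with ℋ³(Π_θ(f(B_par(w,r)))) ≥ δ·r³. -/

import Mathlib

open scoped ENNReal

namespace HeisRug

/-- The first Heisenberg group, as a set: ℝ³. -/
abbrev Hei : Type := ℝ × ℝ × ℝ

/-- Heisenberg group multiplication. -/
noncomputable def Hmul (p q : Hei) : Hei :=
  (p.1 + q.1, p.2.1 + q.2.1, p.2.2 + q.2.2 + (p.1 * q.2.1 - q.1 * p.2.1) / 2)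

/-- Heisenberg group inverse. -/
def Hinv (p : Hei) : Hei := (-p.1, -p.2.1, -p.2.2)

/-- Homogeneous norm on the Heisenberg group. -/
noncomputable def Hnorm (p : Hei) : ℝ :=
  max (Real.sqrt (p.1 ^ 2 + p.2.1 ^ 2)) (Real.sqrt |p.2.2|)

/-- Left-invariant metric `d(p,q) = ‖q⁻¹·p‖` on the Heisenberg group. -/
noncomputable def dH (p q : Hei) : ℝ := Hnorm (Hmul (Hinv q) p)

/-- Parabolic metric on the parabolic plane 𝕎 = ℝ². -/
noncomputable def dPar (w w' : ℝ × ℝ) : ℝ :=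
  max |w.1 - w'.1| (Real.sqrt |w.2 - w'.2|)

/-- Distance from a point to a set in (ℍ, d). -/
noncomputable def distH (p : Hei) (E : Set Hei) : ℝ := sInf ((dH p) '' E)

/-- Closed δ-neighbourhood of a set in ℍ. -/
def NH (E : Set Hei) (δ : ℝ) : Set Hei := {p | distH p E ≤ δ}

/-- Closed ball in (ℍ, d). -/
def BH (p : Hei) (r : ℝ) : Set Hei := {q | dH q p ≤ r}

/-- Closed parabolic ball in 𝕎. -/
def BPar (w : ℝ × ℝ) (r : ℝ) : Set (ℝ × ℝ) := {v | dPar v w ≤ r}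

/-- Diameter (in ℝ≥0∞) with respect to the Heisenberg metric. -/
noncomputable def ediamH (E : Set Hei) : ℝ≥0∞ :=
  ⨆ p ∈ E, ⨆ q ∈ E, ENNReal.ofReal (dH p q)

/-- The 3-dimensional Hausdorff measure on (ℍ, d), as a set function. -/
noncomputable def H3 (E : Set Hei) : ℝ≥0∞ :=
  ⨆ (δ : ℝ≥0∞) (_ : 0 < δ),
    ⨅ (U : ℕ → Set Hei) (_ : E ⊆ ⋃ n, U n) (_ : ∀ n, ediamH (U n) ≤ δ),
      ∑' n, ediamH (U n) ^ 3

/-- Isometric embedding of the parabolic plane onto the subgroup 𝕎 ⊂ ℍ. -/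
def embedW (w : ℝ × ℝ) : Hei := (0, w.1, w.2)

/-- The vertical subgroup 𝕎 = {(0,y,t)} of ℍ. -/
def Wsub : Set Hei := {p | p.1 = 0}

/-- Rotation by angle θ about the t-axis. -/
noncomputable def Rrot (θ : ℝ) (p : Hei) : Hei :=
  (p.1 * Real.cos θ - p.2.1 * Real.sin θ, p.1 * Real.sin θ + p.2.1 * Real.cos θ, p.2.2)

/-- Vertical projection Π : ℍ → 𝕎. -/
noncomputable def Piproj (p : Hei) : Hei := (0, p.2.1, p.2.2 + p.1 * p.2.1 / 2)

/-- Horizontal projection Π_𝕃 : ℍ → 𝕃. -/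
def PiL (p : Hei) : Hei := (p.1, 0, 0)

/-- Vertical projection Π_θ = R_θ ∘ Π ∘ R_θ⁻¹ onto 𝕎_θ. -/
noncomputable def PiTheta (θ : ℝ) (p : Hei) : Hei := Rrot θ (Piproj (Rrot (-θ) p))

/-- `f : 𝕎 → ℍ` is M-bilipschitz. -/
def IsBilipschitz (M : ℝ) (f : ℝ × ℝ → Hei) : Prop :=
  ∀ w w' : ℝ × ℝ,
    M⁻¹ * dPar w w' ≤ dH (f w) (f w') ∧ dH (f w) (f w') ≤ M * dPar w w'

/-- A Rickman rug: the image of the parabolic plane under a bilipschitz map. -/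
def IsRickmanRug (E : Set Hei) : Prop :=
  ∃ M : ℝ, 1 ≤ M ∧ ∃ f : ℝ × ℝ → Hei, IsBilipschitz M f ∧ E = Set.range f

/-- A horizontal line in ℍ. -/
def IsHorizontalLine (L : Set Hei) : Prop :=
  ∃ p : Hei, ∃ v : ℝ × ℝ, v ≠ 0 ∧
    L = {q | ∃ s : ℝ, q = Hmul p (s * v.1, s * v.2, 0)}

/-- The vertical plane spanned by a horizontal line. -/
def VSpan (L : Set Hei) : Set Hei := {q | ∃ p ∈ L, ∃ t : ℝ, q = Hmul p (0, 0, t)}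

/-- Vertical planes in ℍ. -/
def IsVerticalPlane (V : Set Hei) : Prop :=
  ∃ L : Set Hei, IsHorizontalLine L ∧ V = VSpan L

/-- The horizontal line {(a·y + b, y, b·y/2 + c) : y ∈ ℝ} (of slope |a|). -/
def hline (a b c : ℝ) : Set Hei :=
  {p | ∃ y : ℝ, p = (a * y + b, y, b * y / 2 + c)}

/-- A horizontal line of (finite) slope at most Σ. -/
def HLineSlopeLe (S : ℝ) (L : Set Hei) : Prop :=
  ∃ a b c : ℝ, |a| ≤ S ∧ L = hline a b c

/-- A vertical plane of (finite) slope at most Σ (relative to 𝕎). -/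
def VPlaneSlopeLe (S : ℝ) (V : Set Hei) : Prop :=
  ∃ a b : ℝ, |a| ≤ S ∧ V = {p : Hei | p.1 = a * p.2.1 + b}

/-- A vertical plane whose slope relative to 𝕎_θ equals 0. -/
def SlopeZeroRel (θ : ℝ) (V : Set Hei) : Prop :=
  ∃ b : ℝ, Rrot (-θ) '' V = {p : Hei | p.1 = b}

/-- The horizontal line ℝ × {t} in the parabolic plane. -/
def lineW (t : ℝ) : Set (ℝ × ℝ) := {w | w.2 = t}

/-- Ruler coefficient ρ_f(B_par(w,r)). -/
noncomputable def rulerCoef (f : ℝ × ℝ → Hei) (w : ℝ × ℝ) (r : ℝ) : ℝ :=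
  sInf {ρ : ℝ | 0 < ρ ∧ ∀ t : ℝ, ∃ L : Set Hei, IsHorizontalLine L ∧
    f '' (lineW t ∩ BPar w r) ⊆ NH L (ρ * r)}

/-- β_f(𝕍; B_par(w,r)): approximation number relative to the vertical plane 𝕍. -/
noncomputable def betaV (f : ℝ × ℝ → Hei) (V : Set Hei) (w : ℝ × ℝ) (r : ℝ) : ℝ :=
  sInf {ε : ℝ | 0 < ε ∧ ∀ t : ℝ, ∃ L : Set Hei, IsHorizontalLine L ∧ L ⊆ V ∧
    f '' (lineW t ∩ BPar w r) ⊆ NH L (ε * r)}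

/-- The strong vertical β-number β_f(B_par(w,r)) = inf_𝕍 β_f(𝕍; B_par(w,r)). -/
noncomputable def beta (f : ℝ × ℝ → Hei) (w : ℝ × ℝ) (r : ℝ) : ℝ :=
  sInf {b : ℝ | ∃ V : Set Hei, IsVerticalPlane V ∧ b = betaV f V w r}

/-- Index set for dyadic parabolic rectangles: (n, k, l). -/
abbrev Idx : Type := ℤ × ℤ × ℤ

/-- Side length ℓ(Q) = 2⁻ⁿ of the dyadic parabolic rectangle with index (n,k,l). -/
noncomputable def sideLen (i : Idx) : ℝ := (2 : ℝ) ^ (-i.1)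

/-- The dyadic parabolic rectangle [k·2⁻ⁿ, (k+1)·2⁻ⁿ) × [l·4⁻ⁿ, (l+1)·4⁻ⁿ). -/
noncomputable def rect (i : Idx) : Set (ℝ × ℝ) :=
  Set.Ico ((i.2.1 : ℝ) * (2 : ℝ) ^ (-i.1)) (((i.2.1 : ℝ) + 1) * (2 : ℝ) ^ (-i.1)) ×ˢ
  Set.Ico ((i.2.2 : ℝ) * (4 : ℝ) ^ (-i.1)) (((i.2.2 : ℝ) + 1) * (4 : ℝ) ^ (-i.1))

/-- The centre c_Q of a dyadic parabolic rectangle. -/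
noncomputable def center (i : Idx) : ℝ × ℝ :=
  (((i.2.1 : ℝ) + 1 / 2) * (2 : ℝ) ^ (-i.1), ((i.2.2 : ℝ) + 1 / 2) * (4 : ℝ) ^ (-i.1))

/-- λQ := B_par(c_Q, λ·ℓ(Q)). -/
noncomputable def dilate (lam : ℝ) (i : Idx) : Set (ℝ × ℝ) := BPar (center i) (lam * sideLen i)

/-- j indexes a 𝒟-child of the rectangle indexed by i. -/
def IsChild (j i : Idx) : Prop := j.1 = i.1 + 1 ∧ rect j ⊆ rect i

/-- T ⊆ 𝒟 is a tree with root rt. -/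
def IsTreeWithRoot (T : Set Idx) (rt : Idx) : Prop :=
  rt ∈ T ∧ (∀ i ∈ T, rect i ⊆ rect rt) ∧
  (∀ i j k : Idx, i ∈ T → k ∈ T → rect i ⊆ rect j → rect j ⊆ rect k → j ∈ T) ∧
  (∀ i ∈ T, (∀ j : Idx, IsChild j i → j ∈ T) ∨ (∀ j : Idx, IsChild j i → j ∉ T))

/-- T ⊆ 𝒟 is a tree. -/
def IsTree (T : Set Idx) : Prop := ∃ rt : Idx, IsTreeWithRoot T rt

/-- Q is (ε,H,Σ)-vertical for f : there is a vertical plane 𝕍_Q of slope ≤ Σ with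
β_f(𝕍_Q; HQ) < ε/H. -/
def IsVerticalRect (f : ℝ × ℝ → Hei) (ε Hc S : ℝ) (i : Idx) : Prop :=
  ∃ V : Set Hei, VPlaneSlopeLe S V ∧ betaV f V (center i) (Hc * sideLen i) < ε / Hc

/-- Q is (δ,C)-ruled for f. -/
def IsRuled (f : ℝ × ℝ → Hei) (δ C : ℝ) (i : Idx) : Prop :=
  ∀ t : ℝ, ∃ L : Set Hei, IsHorizontalLine L ∧
    f '' (lineW t ∩ dilate C i) ⊆ NH L (δ * sideLen i)

/-- Q is (δ,C,Σ)-ruled for f. -/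
def IsRuledSlope (f : ℝ × ℝ → Hei) (δ C S : ℝ) (i : Idx) : Prop :=
  IsRuled f δ C i ∧ ∃ t : ℝ, (lineW t ∩ rect i).Nonempty ∧
    ∃ L : Set Hei, HLineSlopeLe S L ∧
      f '' (lineW t ∩ dilate C i) ⊆ NH L (δ * sideLen i)

/-- Γ is an intrinsic L-Lipschitz graph over 𝕎. -/
def IsIntrinsicLipGraph (L : ℝ) (Γ : Set Hei) : Prop :=
  Set.BijOn Piproj Γ Wsub ∧
  ∀ p ∈ Γ, ∀ q ∈ Γ,
    Hnorm (PiL (Hmul (Hinv q) p)) ≤ L * Hnorm (Piproj (Hmul (Hinv q) p))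

/-- Γ is an intrinsic L-Lipschitz graph over 𝕎_θ. -/
def IsIntrinsicLipGraphOver (θ L : ℝ) (Γ : Set Hei) : Prop :=
  IsIntrinsicLipGraph L (Rrot (-θ) '' Γ)

/-- An intrinsic bilipschitz graph: an intrinsic Lipschitz graph over some vertical
subgroup which is also a Rickman rug. -/
def IsIntrinsicBilipGraph (Γ : Set Hei) : Prop :=
  (∃ θ ∈ Set.Ico (-(Real.pi / 2)) (Real.pi / 2), ∃ L : ℝ, 1 ≤ L ∧
    IsIntrinsicLipGraphOver θ L Γ) ∧ IsRickmanRug Γ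

/-- (M,ε)-quasi-isometric embedding between sets with distance functions. -/
def IsQIEOn {X Y : Type*} (dX : X → X → ℝ) (dY : Y → Y → ℝ) (A : Set X)
    (M ε : ℝ) (F : X → Y) : Prop :=
  ∀ x ∈ A, ∀ x' ∈ A,
    M⁻¹ * dX x x' - ε ≤ dY (F x) (F x') ∧ dY (F x) (F x') ≤ M * dX x x' + ε

/-- d is a metric on ℝ. -/
def IsMetricOn (d : ℝ → ℝ → ℝ) : Prop :=
  (∀ x y, d x y = d y x) ∧ (∀ x y, d x y = 0 ↔ x = y) ∧
  (∀ x y z, d x z ≤ d x y + d y z)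

/-- d is an orderly metric on ℝ. -/
def Orderly (d : ℝ → ℝ → ℝ) : Prop :=
  IsMetricOn d ∧
  (∀ x : ℝ, ∀ ε > (0 : ℝ), ∃ δ > (0 : ℝ), ∀ y : ℝ, |x - y| < δ → d x y < ε) ∧
  (∀ x y z : ℝ, x ≤ y → y ≤ z → max (d x y) (d y z) ≤ d x z)

/-- F : I×J → 𝕎 is a horizontal (M,ε)-QIE. -/
def IsHorizQIE (M ε : ℝ) (I J : Set ℝ) (F : ℝ × ℝ → ℝ × ℝ) : Prop :=
  IsQIEOn dPar dPar (I ×ˢ J) M ε F ∧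
  (∀ t ∈ J, ∃ c : ℝ, ∀ y ∈ I, (F (y, t)).2 = c)



lemma pm_path (φ : ℝ → ℝ) (x y : ℝ) (hxy : x ≤ y) (hc : ContinuousOn φ (Set.Icc x y))
    (σ : ℝ → ℝ) (hσ : ∀ z, σ (z + Real.pi) = - σ z)
    (h : ∀ s ∈ Set.Icc x y, 0 < σ (φ s)) : |φ y - φ x| < Real.pi := by
  by_contra hcon
  rw [not_lt, le_abs] at hcon
  have hx := h x ⟨le_rfl, hxy⟩
  have hpi := Real.pi_pos
  rcases hcon with hcon | hcon
  · obtain ⟨s, hs, hs'⟩ := intermediate_value_Icc hxy hc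
      (show φ x + Real.pi ∈ Set.Icc (φ x) (φ y) from ⟨by linarith, by linarith⟩)
    have := h s hs
    rw [hs', hσ] at this
    linarith
  · obtain ⟨s, hs, hs'⟩ := intermediate_value_Icc' hxy hc
      (show φ x - Real.pi ∈ Set.Icc (φ y) (φ x) from ⟨by linarith, by linarith⟩)
    have h1 := h s hs
    have h2 := hσ (φ s)
    rw [hs'] at h1 h2
    rw [sub_add_cancel] at h2
    linarith

lemma pm_pos {z : ℝ} (h : |z| < Real.pi) (hs : 0 < Real.sin z) : 0 < z := by
  by_contra hz
  have := Real.sin_nonpos_of_nonpos_of_neg_pi_le (not_lt.mp hz) (by linarith [(abs_lt.mp h).1])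
  linarith

/-- Two-dimensional Poincaré–Miranda theorem on a rectangle. -/
lemma poincare_miranda (F1 F2 : ℝ × ℝ → ℝ) (h1 : Continuous F1) (h2 : Continuous F2)
    (K : ℝ) (hK : 0 ≤ K)
    (hl : ∀ t ∈ Set.Icc (0:ℝ) 1, F1 (0, t) < 0) (hr : ∀ t ∈ Set.Icc (0:ℝ) 1, 0 < F1 (K, t))
    (hb : ∀ s ∈ Set.Icc (0:ℝ) K, F2 (s, 0) < 0) (ht : ∀ s ∈ Set.Icc (0:ℝ) K, 0 < F2 (s, 1)) :
    ∃ s ∈ Set.Icc (0:ℝ) K, ∃ t ∈ Set.Icc (0:ℝ) 1, F1 (s, t) = 0 ∧ F2 (s, t) = 0 := by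
  by_contra hcon
  push Not at hcon
  have h01 : (0:ℝ) ≤ 1 := zero_le_one
  let c : ℝ × ℝ → ℝ × ℝ := fun z => (Set.projIcc 0 K hK z.1, Set.projIcc 0 1 h01 z.2)
  have hc : Continuous c := by
    refine Continuous.prodMk ?_ ?_
    · exact continuous_subtype_val.comp (continuous_projIcc.comp continuous_fst)
    · exact continuous_subtype_val.comp (continuous_projIcc.comp continuous_snd)
  have hcid : ∀ s ∈ Set.Icc (0:ℝ) K, ∀ t ∈ Set.Icc (0:ℝ) 1, c (s, t) = (s, t) := by
    intro s hs t ht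
    simp only [c, Set.projIcc_of_mem hK hs, Set.projIcc_of_mem h01 ht]
  let g : ℝ × ℝ → ℂ := fun z => ⟨F1 (c z), F2 (c z)⟩
  have hg : Continuous g := by
    have : g = fun z => (F1 (c z) : ℂ) + (F2 (c z) : ℂ) * Complex.I := by
      funext z; apply Complex.ext <;> simp [g]
    rw [this]
    have := h1.comp hc
    have := h2.comp hc
    fun_prop
  have hg0 : (0:ℂ) ∉ g '' Set.univ := by
    rintro ⟨z, -, hz⟩
    have e1 : F1 (c z) = 0 := congrArg Complex.re hz
    have e2 : F2 (c z) = 0 := congrArg Complex.im hz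
    exact hcon _ (Set.projIcc 0 K hK z.1).2 _ (Set.projIcc 0 1 h01 z.2).2 e1 e2
  have hsc : IsSimplyConnected (Set.univ : Set (ℝ × ℝ)) := by
    have := (convex_univ (𝕜 := ℝ) (E := ℝ × ℝ)).contractibleSpace Set.univ_nonempty
    exact inferInstanceAs (SimplyConnectedSpace _)
  obtain ⟨G, hG, hGe⟩ := Complex.exists_continuousOn_eqOn_exp_comp hsc isOpen_univ
    hg.continuousOn hg0
  rw [continuousOn_univ] at hG
  let φ : ℝ → ℝ → ℝ := fun s t => (G (s, t)).im
  have hφs : ∀ t, Continuous fun s => φ s t := fun t =>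
    Complex.continuous_im.comp (hG.comp (by fun_prop))
  have hφt : ∀ s, Continuous fun t => φ s t := fun s =>
    Complex.continuous_im.comp (hG.comp (by fun_prop))
  have key : ∀ s ∈ Set.Icc (0:ℝ) K, ∀ t ∈ Set.Icc (0:ℝ) 1, ∃ ρ > 0,
      F1 (s, t) = ρ * Real.cos (φ s t) ∧ F2 (s, t) = ρ * Real.sin (φ s t) := by
    intro s hs t ht
    have := hGe (Set.mem_univ (s, t))
    simp only [Function.comp, g, hcid s hs t ht] at this
    refine ⟨Real.exp (G (s, t)).re, Real.exp_pos _, ?_, ?_⟩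
    · rw [← Complex.exp_re, this]
    · rw [← Complex.exp_im, this]
  have K0 : (0:ℝ) ∈ Set.Icc 0 K := ⟨le_rfl, hK⟩
  have KK : K ∈ Set.Icc 0 K := ⟨hK, le_rfl⟩
  have I0 : (0:ℝ) ∈ Set.Icc (0:ℝ) 1 := ⟨le_rfl, h01⟩
  have I1 : (1:ℝ) ∈ Set.Icc (0:ℝ) 1 := ⟨h01, le_rfl⟩
  have cl : ∀ t ∈ Set.Icc (0:ℝ) 1, 0 < - Real.cos (φ 0 t) := by
    intro t ht
    obtain ⟨ρ, hρ, e, -⟩ := key 0 K0 t ht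
    have := hl t ht
    by_contra hh
    have : 0 ≤ ρ * Real.cos (φ 0 t) := mul_nonneg hρ.le (by linarith)
    linarith
  have cr : ∀ t ∈ Set.Icc (0:ℝ) 1, 0 < Real.cos (φ K t) := by
    intro t ht
    obtain ⟨ρ, hρ, e, -⟩ := key K KK t ht
    have := hr t ht
    rw [e] at this
    exact (mul_pos_iff_of_pos_left hρ).mp this
  have sb : ∀ s ∈ Set.Icc (0:ℝ) K, 0 < - Real.sin (φ s 0) := by
    intro t ht
    obtain ⟨ρ, hρ, -, e⟩ := key t ht 0 I0
    have := hb t ht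
    by_contra hh
    have : 0 ≤ ρ * Real.sin (φ t 0) := mul_nonneg hρ.le (by linarith)
    linarith
  have st : ∀ s ∈ Set.Icc (0:ℝ) K, 0 < Real.sin (φ s 1) := by
    intro t ht'
    obtain ⟨ρ, hρ, -, e⟩ := key t ht' 1 I1
    have := ht t ht'
    rw [e] at this
    exact (mul_pos_iff_of_pos_left hρ).mp this
  have a1 := pm_path (fun t => φ K t) 0 1 h01 (hφt K).continuousOn Real.cos Real.cos_add_pi cr
  have a2 := pm_path (fun s => φ s 1) 0 K hK (hφs 1).continuousOn Real.sin Real.sin_add_pi st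
  have a3 := pm_path (fun t => φ 0 t) 0 1 h01 (hφt 0).continuousOn (fun z => - Real.cos z)
    (fun z => by simp [Real.cos_add_pi]) cl
  have a4 := pm_path (fun s => φ s 0) 0 K hK (hφs 0).continuousOn (fun z => - Real.sin z)
    (fun z => by simp [Real.sin_add_pi]) sb
  rw [abs_sub_comm] at a2 a3
  have cl0 := cl 0 I0
  have cl1 := cl 1 I1
  have cr0 := cr 0 I0
  have cr1 := cr 1 I1
  have sb0 := sb 0 K0
  have sbK := sb K KK
  have st0 := st 0 K0
  have stK := st K KK
  have b1 := pm_pos a1 (by rw [Real.sin_sub]; nlinarith)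
  have b2 := pm_pos a2 (by rw [Real.sin_sub]; nlinarith)
  have b3 := pm_pos a3 (by rw [Real.sin_sub]; nlinarith)
  have b4 := pm_pos a4 (by rw [Real.sin_sub]; nlinarith)
  linarith

/-- Second coordinate of the vertical projection. -/
noncomputable def F2 (p : Hei) : ℝ := p.2.2 + p.1 * p.2.1 / 2

/-- Vertical component of `q⁻¹ p`. -/
noncomputable def tt (q p : Hei) : ℝ := p.2.2 - q.2.2 + (q.2.1 * p.1 - q.1 * p.2.1) / 2

lemma dH_le_iff {p q : Hei} {c : ℝ} (hc : 0 ≤ c) :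
    dH p q ≤ c ↔ (p.1 - q.1) ^ 2 + (p.2.1 - q.2.1) ^ 2 ≤ c ^ 2 ∧ |tt q p| ≤ c ^ 2 := by
  unfold dH Hnorm Hmul Hinv tt
  simp only [max_le_iff]
  rw [Real.sqrt_le_left hc, Real.sqrt_le_left hc]
  have e1 : (-q.1 + p.1) ^ 2 + (-q.2.1 + p.2.1) ^ 2 =
    (p.1 - q.1) ^ 2 + (p.2.1 - q.2.1) ^ 2 := by ring
  have e2 : -q.2.2 + p.2.2 + (-q.1 * p.2.1 - p.1 * -q.2.1) / 2 =
    p.2.2 - q.2.2 + (q.2.1 * p.1 - q.1 * p.2.1) / 2 := by ring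
  rw [e1, e2]

lemma F2_sub (p q : Hei) : F2 p - F2 q =
    tt q p + (p.1 - q.1) * (p.2.1 - q.2.1) / 2 + q.1 * (p.2.1 - q.2.1) := by
  unfold F2 tt; ring

lemma dH_nonneg (p q : Hei) : 0 ≤ dH p q :=
  le_max_of_le_left (Real.sqrt_nonneg _)

lemma dH_X {p q : Hei} {c : ℝ} (h : dH p q ≤ c) : |p.1 - q.1| ≤ c := by
  have hc := (dH_nonneg p q).trans h
  have := ((dH_le_iff hc).mp h).1
  apply abs_le_of_sq_le_sq _ hc
  nlinarith [sq_nonneg (p.2.1 - q.2.1)]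

lemma dH_Y {p q : Hei} {c : ℝ} (h : dH p q ≤ c) : |p.2.1 - q.2.1| ≤ c := by
  have hc := (dH_nonneg p q).trans h
  have := ((dH_le_iff hc).mp h).1
  apply abs_le_of_sq_le_sq _ hc
  nlinarith [sq_nonneg (p.1 - q.1)]

lemma dH_F2 {p q : Hei} {c : ℝ} (h : dH p q ≤ c) :
    |F2 p - F2 q| ≤ 2 * c ^ 2 + |q.1| * c := by
  have hc := (dH_nonneg p q).trans h
  have h1 := ((dH_le_iff hc).mp h).2
  have h2 := dH_X h
  have h3 := dH_Y h
  rw [F2_sub]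
  have h4 : |(p.1 - q.1) * (p.2.1 - q.2.1) / 2| ≤ c ^ 2 := by
    rw [abs_div, abs_mul, abs_two]
    have := mul_le_mul h2 h3 (abs_nonneg _) hc
    nlinarith [abs_nonneg (p.1 - q.1), abs_nonneg (p.2.1 - q.2.1)]
  have h5 : |q.1 * (p.2.1 - q.2.1)| ≤ |q.1| * c := by
    rw [abs_mul]; exact mul_le_mul_of_nonneg_left h3 (abs_nonneg _)
  have := abs_add_le (tt q p + (p.1 - q.1) * (p.2.1 - q.2.1) / 2) (q.1 * (p.2.1 - q.2.1))
  have := abs_add_le (tt q p) ((p.1 - q.1) * (p.2.1 - q.2.1) / 2)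
  linarith

lemma dPar_nonneg (v w : ℝ × ℝ) : 0 ≤ dPar v w := le_max_of_le_left (abs_nonneg _)

lemma dPar_horiz (s s' t : ℝ) : dPar (s, t) (s', t) = |s - s'| := by
  simp [dPar]

lemma area_lemma (γ : ℝ → Hei) (M S ξ : ℝ) (hM : 0 ≤ M) (hS : 0 ≤ S)
    (h0 : γ 0 = (0, 0, 0))
    (hL : ∀ s s' : ℝ, dH (γ s) (γ s') ≤ M * |s - s'|)
    (hX : ∀ s ∈ Set.Icc 0 S, |(γ s).1| ≤ ξ) : |F2 (γ S)| ≤ ξ * M * S := by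
  have step : ∀ N : ℕ, 0 < N → |F2 (γ S)| ≤ ξ * M * S + 2 * M ^ 2 * S ^ 2 / N := by
    intro N hN
    have hN' : (0:ℝ) < N := by exact_mod_cast hN
    set d : ℝ := S / N with hd
    have hd0 : 0 ≤ d := by positivity
    have hdN : N * d = S := by rw [hd]; field_simp
    have ind : ∀ i : ℕ, i ≤ N → |F2 (γ (i * d))| ≤ i * (2 * (M * d) ^ 2 + ξ * (M * d)) := by
      intro i
      induction i with
      | zero => intro _; simp [h0, F2]
      | succ k ih =>
        intro hk
        have ih := ih (by omega)
        have hk' : (k:ℝ) ≤ N := by exact_mod_cast (by omega : k ≤ N)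
        have e : dH (γ ((k + 1 : ℕ) * d)) (γ (k * d)) ≤ M * d := by
          refine (hL _ _).trans (le_of_eq ?_)
          congr 1
          push_cast
          rw [show ((k:ℝ) + 1) * d - k * d = d by ring, abs_of_nonneg hd0]
        have e2 := dH_F2 e
        have e3 := hX (k * d) ⟨by positivity, by rw [← hdN]; gcongr⟩
        have e4 : |(γ (k * d)).1| * (M * d) ≤ ξ * (M * d) := by gcongr
        have e5 := abs_sub_abs_le_abs_sub (F2 (γ ((k + 1 : ℕ) * d))) (F2 (γ (k * d)))
        push_cast at *
        linarith
    have := ind N le_rfl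
    rw [hdN] at this
    refine this.trans (le_of_eq ?_)
    rw [hd]; field_simp; ring
  by_contra hcon
  push Not at hcon
  obtain ⟨N, hN⟩ := exists_nat_gt (2 * M ^ 2 * S ^ 2 / (|F2 (γ S)| - ξ * M * S))
  have hpos : 0 < |F2 (γ S)| - ξ * M * S := by linarith
  have hN0 : (0:ℝ) < N := lt_of_le_of_lt (by positivity) hN
  have := step N (by exact_mod_cast hN0)
  rw [div_lt_iff₀ hpos] at hN
  have h2 : 2 * M ^ 2 * S ^ 2 / N < |F2 (γ S)| - ξ * M * S := by
    rw [div_lt_iff₀ hN0]; linarith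
  linarith

def Straight (L K ε : ℝ) (γ : ℝ → Hei) : Prop :=
  ∀ s ∈ Set.Icc 0 K, |(γ s).1| ≤ ε ∧ |(γ s).2.1 - L * s| ≤ ε ∧ |F2 (γ s)| ≤ ε

lemma straighten (γ : ℝ → Hei) (M K L ξ η σ ε : ℝ) (hM : 1 ≤ M) (hK : 1 ≤ K)
    (hL0 : 0 ≤ L) (hLM : L ≤ 2 * M) (hξ : 0 ≤ ξ) (hη : 0 ≤ η) (hσ : 0 < σ) (hσK : σ ≤ K)
    (hξη : 4 * M * K * η ≤ ξ ^ 2) (hηξ : η ≤ ξ) (hε : (ξ + 3 * M * σ) * M * K ≤ ε)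
    (h0 : γ 0 = (0, 0, 0))
    (hL : ∀ s s' : ℝ, dH (γ s) (γ s') ≤ M * |s - s'|)
    (hchord : ∀ s s' : ℝ, 0 ≤ s → s' ≤ K → σ ≤ s' - s →
      ((γ s').1 - (γ s).1) ^ 2 + ((γ s').2.1 - (γ s).2.1) ^ 2 ≤ (L * (s' - s)) ^ 2)
    (hend : L * K - η ≤ (γ K).2.1) : Straight L K ε γ := by
  have hx0 : (γ 0).1 = 0 := by rw [h0]
  have hy0 : (γ 0).2.1 = 0 := by rw [h0]
  have hMσ : 0 ≤ M * σ := by positivity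
  have main : ∀ s, σ ≤ s → s ≤ K → (σ ≤ K - s ∨ s = K) →
      |(γ s).1| ≤ ξ ∧ |(γ s).2.1 - L * s| ≤ η := by
    intro s hs1 hs2 hs3
    have c1 := hchord 0 s le_rfl hs2 (by linarith)
    rw [hx0, hy0, sub_zero, sub_zero, sub_zero] at c1
    have hLs : 0 ≤ L * s := mul_nonneg hL0 (by linarith)
    have hY : |(γ s).2.1| ≤ L * s := by
      apply abs_le_of_sq_le_sq _ hLs
      nlinarith [sq_nonneg (γ s).1]
    rw [abs_le] at hY
    have hlow : L * s - η ≤ (γ s).2.1 := by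
      rcases hs3 with h | h
      · have c2 := hchord s K (by linarith) le_rfl h
        have : |(γ K).2.1 - (γ s).2.1| ≤ L * (K - s) := by
          apply abs_le_of_sq_le_sq _ (mul_nonneg hL0 (by linarith))
          nlinarith [sq_nonneg ((γ K).1 - (γ s).1)]
        rw [abs_le] at this
        linarith
      · rw [h]; exact hend
    refine ⟨?_, ?_⟩
    · apply abs_le_of_sq_le_sq _ hξ
      have : (γ s).1 ^ 2 ≤ (L * s - (γ s).2.1) * (L * s + (γ s).2.1) := by nlinarith
      have h2 : (L * s - (γ s).2.1) * (L * s + (γ s).2.1) ≤ η * (4 * M * K) := by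
        apply mul_le_mul (by linarith) _ (by linarith) hη
        have : L * s ≤ 2 * M * K := mul_le_mul hLM hs2 (by linarith) (by linarith)
        linarith
      linarith
    · rw [abs_le]; constructor <;> linarith
  have hXY : ∀ s ∈ Set.Icc 0 K, |(γ s).1| ≤ ξ + 3 * M * σ ∧
      |(γ s).2.1 - L * s| ≤ ξ + 3 * M * σ := by
    intro s hs
    by_cases h1 : σ ≤ s
    · by_cases h2 : σ ≤ K - s ∨ s = K
      · have := main s h1 hs.2 h2
        constructor <;> linarith [this.1, this.2]
      · push Not at h2
        have hKs := main K hσK le_rfl (Or.inr rfl)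
        have d1 : dH (γ s) (γ K) ≤ M * σ := by
          refine (hL s K).trans ?_
          rw [abs_sub_comm, abs_of_nonneg (by linarith [hs.2])]
          gcongr; exact h2.1.le
        have d2 := abs_le.mp (dH_X d1)
        have d3 := abs_le.mp (dH_Y d1)
        have hk1 := abs_le.mp hKs.1
        have hk2 := abs_le.mp hKs.2
        have hls : L * (K - s) ≤ 2 * M * σ :=
          mul_le_mul hLM h2.1.le (by linarith [hs.2]) (by linarith)
        have hls' : 0 ≤ L * (K - s) := mul_nonneg hL0 (by linarith [hs.2])
        constructor
        · rw [abs_le]; constructor <;> linarith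
        · rw [abs_le]; constructor <;> linarith
    · push Not at h1
      have d1 : dH (γ s) (γ 0) ≤ M * σ := by
        refine (hL s 0).trans ?_
        rw [sub_zero, abs_of_nonneg hs.1]
        gcongr
      have d2 := abs_le.mp (dH_X d1)
      have d3 := abs_le.mp (dH_Y d1)
      rw [hx0] at d2
      rw [hy0] at d3
      have hls : L * s ≤ 2 * M * σ := mul_le_mul hLM h1.le hs.1 (by linarith)
      have hls' : 0 ≤ L * s := mul_nonneg hL0 hs.1
      constructor
      · rw [abs_le]; constructor <;> linarith
      · rw [abs_le]; constructor <;> linarith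
  have hnn : 0 ≤ ξ + 3 * M * σ := by positivity
  have hMK : 1 ≤ M * K := by nlinarith
  have hle : ξ + 3 * M * σ ≤ ε := by nlinarith
  intro s hs
  refine ⟨(hXY s hs).1.trans hle, (hXY s hs).2.trans hle, ?_⟩
  have := area_lemma γ M s (ξ + 3 * M * σ) (by linarith) hs.1 h0 hL
    (fun s' hs' => (hXY s' ⟨hs'.1, hs'.2.trans hs.2⟩).1)
  refine this.trans (le_trans ?_ hε)
  exact mul_le_mul_of_nonneg_left hs.2 (by positivity)

lemma cont_dPar (w : ℝ × ℝ) : Continuous fun v => dPar v w := by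
  unfold dPar; fun_prop

lemma cont_Y {g : ℝ × ℝ → Hei} {M : ℝ} (hg : IsBilipschitz M g) :
    Continuous fun v => (g v).2.1 := by
  rw [continuous_iff_continuousAt]
  intro w
  rw [ContinuousAt, tendsto_iff_dist_tendsto_zero]
  have hlim : Filter.Tendsto (fun v => M * dPar v w) (nhds w) (nhds 0) := by
    have : Continuous fun v => M * dPar v w := continuous_const.mul (cont_dPar w)
    have h := this.tendsto w
    simpa [dPar] using h
  refine squeeze_zero (fun _ => dist_nonneg) (fun v => ?_) hlim
  rw [Real.dist_eq]
  exact dH_Y (hg v w).2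

lemma cont_F2 {g : ℝ × ℝ → Hei} {M : ℝ} (hg : IsBilipschitz M g) :
    Continuous fun v => F2 (g v) := by
  rw [continuous_iff_continuousAt]
  intro w
  rw [ContinuousAt, tendsto_iff_dist_tendsto_zero]
  have hlim : Filter.Tendsto (fun v => 2 * (M * dPar v w) ^ 2 + |(g w).1| * (M * dPar v w))
      (nhds w) (nhds 0) := by
    have := cont_dPar w
    have : Continuous fun v => 2 * (M * dPar v w) ^ 2 + |(g w).1| * (M * dPar v w) := by fun_prop
    have h := this.tendsto w
    simpa [dPar] using h
  refine squeeze_zero (fun _ => dist_nonneg) (fun v => ?_) hlim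
  rw [Real.dist_eq]
  exact dH_F2 (hg v w).2

lemma F2_rel (p g : Hei) :
    F2 (Hmul (Hinv p) g) = F2 g - F2 p - p.1 * (g.2.1 - p.2.1) := by
  unfold F2 Hmul Hinv; ring

set_option maxHeartbeats 1000000 in
lemma core (g : ℝ × ℝ → Hei) (M L K ε : ℝ) (hM : 1 ≤ M) (hg : IsBilipschitz M g)
    (hL : 1 ≤ 2 * M ^ 3 * L) (hK : K = 2000 * M ^ 12)
    (hε0 : 0 ≤ ε) (hε : ε * M ^ 2 ≤ 1 / 100) (h0 : g (0, 0) = (0, 0, 0))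
    (s0 : Straight L K ε (fun s => g (s, 0)))
    (s1 : Straight L K ε (fun s => Hmul (Hinv (g (0, 1))) (g (s, 1)))) :
    ∃ v0, ∀ u ∈ Set.Icc (M + 1 / 2) (M + 3 / 2), ∀ v ∈ Set.Icc v0 (v0 + 1 / (8 * M ^ 2)),
      ∃ s ∈ Set.Icc 0 (8 * M ^ 4), ∃ t ∈ Set.Icc (0:ℝ) 1,
        (g (s, t)).2.1 = u ∧ F2 (g (s, t)) = v := by
  have hM0 : 0 < M := by linarith
  obtain ⟨μ, hμ⟩ : ∃ μ, μ = M⁻¹ := ⟨_, rfl⟩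
  have hμM : M * μ = 1 := by rw [hμ]; exact mul_inv_cancel₀ hM0.ne'
  have hμ0 : 0 < μ := by rw [hμ]; positivity
  have hμ1 : μ ≤ 1 := by rw [hμ]; exact inv_le_one_of_one_le₀ hM
  have hL0 : 0 < L := by
    by_contra h
    push Not at h
    have : 2 * M ^ 3 * L ≤ 0 := mul_nonpos_of_nonneg_of_nonpos (by positivity) h
    linarith
  have hM2 : 1 ≤ M ^ 2 := one_le_pow₀ hM
  have hM4 : M ≤ M ^ 4 := le_self_pow₀ hM (by norm_num)
  have hM412 : M ^ 4 ≤ M ^ 12 := pow_le_pow_right₀ hM (by norm_num)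
  have hM12 : 1 ≤ M ^ 12 := one_le_pow₀ hM
  have hεμ : ε ≤ μ ^ 2 / 100 := by
    have : ε = ε * M ^ 2 * μ ^ 2 := by
      rw [mul_assoc, ← mul_pow, hμM]; ring
    rw [this]
    have := mul_le_mul_of_nonneg_right hε (sq_nonneg μ)
    linarith
  have hμ2 : μ ^ 2 ≤ 1 := pow_le_one₀ hμ0.le hμ1
  have hε1 : ε ≤ 1 / 100 := by linarith
  set a := (g (0, 1)).1 with ha
  set b := (g (0, 1)).2.1 with hb
  set A := F2 (g (0, 1)) with hA
  have l0 : ∀ s ∈ Set.Icc 0 K, |(g (s, 0)).1| ≤ ε ∧ |(g (s, 0)).2.1 - L * s| ≤ ε ∧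
      |F2 (g (s, 0))| ≤ ε := s0
  have l1 : ∀ s ∈ Set.Icc 0 K, |(g (s, 1)).1 - a| ≤ ε ∧ |(g (s, 1)).2.1 - b - L * s| ≤ ε ∧
      |F2 (g (s, 1)) - A - a * ((g (s, 1)).2.1 - b)| ≤ ε := by
    intro s hs
    have h := s1 s hs
    simp only [F2_rel] at h
    refine ⟨?_, ?_, h.2.2⟩
    · have := h.1
      simp only [Hmul, Hinv] at this
      rwa [neg_add_eq_sub] at this
    · have := h.2.1
      simp only [Hmul, Hinv] at this
      rwa [neg_add_eq_sub] at this
  have lipv : ∀ s, dH (g (s, 1)) (g (s, 0)) ≤ M := by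
    intro s
    have := (hg (s, 1) (s, 0)).2
    simpa [dPar] using this
  have hxy0 : (g (0, 0)).1 = 0 ∧ (g (0, 0)).2.1 = 0 ∧ F2 (g (0, 0)) = 0 := by
    rw [h0]; simp [F2]
  have hbM : |b| ≤ M := by
    have := dH_Y (lipv 0)
    rwa [hxy0.2.1, sub_zero] at this
  have hAM : |A| ≤ 2 * M ^ 2 := by
    have := dH_F2 (lipv 0)
    rwa [hxy0.1, hxy0.2.2, sub_zero, abs_zero, zero_mul, add_zero] at this
  have hK0 : 0 ≤ K := by rw [hK]; positivity
  -- the transversal displacement `a` is tiny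
  have ha7 : |a| * M ^ 7 ≤ 1 / 100 := by
    have hKK : K ∈ Set.Icc 0 K := ⟨hK0, le_rfl⟩
    have d := dH_F2 (lipv K)
    have k0 := l0 K hKK
    have k1 := l1 K hKK
    have e1 : |(g (K, 0)).1| * M ≤ M ^ 2 := by nlinarith [k0.1]
    have hLK : 1000 * M ^ 9 ≤ L * K := by
      have : L * K = (2 * M ^ 3 * L) * (1000 * M ^ 9) := by rw [hK]; ring
      rw [this]
      exact le_mul_of_one_le_left (by positivity) hL
    have hM9 : 1 ≤ M ^ 9 := one_le_pow₀ hM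
    have hY : 999 * M ^ 9 ≤ (g (K, 1)).2.1 - b := by
      have := (abs_le.mp k1.2.1).1
      linarith
    have hprod : |a * ((g (K, 1)).2.1 - b)| ≤ 6 * M ^ 2 := by
      have i1 := abs_le.mp k1.2.2
      have i2 := abs_le.mp d
      have i3 := abs_le.mp k0.2.2
      have i4 := abs_le.mp hAM
      rw [abs_le]
      constructor <;> linarith
    rw [abs_mul, abs_of_nonneg (by linarith : 0 ≤ (g (K, 1)).2.1 - b)] at hprod
    have h2 : |a| * (999 * M ^ 9) ≤ 6 * M ^ 2 :=
      (mul_le_mul_of_nonneg_left hY (abs_nonneg a)).trans hprod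
    have h3 : (|a| * M ^ 7) * M ^ 2 ≤ (1 / 100) * M ^ 2 := by
      have : (|a| * M ^ 7) * M ^ 2 = |a| * M ^ 9 := by ring
      rw [this]; linarith
    exact le_of_mul_le_mul_right h3 (by positivity)
  have haμ : |a| ≤ μ ^ 2 / 100 := by
    have e : |a| = |a| * M ^ 7 * μ ^ 7 := by
      rw [mul_assoc, ← mul_pow, hμM]; ring
    have h7 : μ ^ 7 ≤ μ ^ 2 := pow_le_pow_of_le_one hμ0.le hμ1 (by norm_num)
    rw [e]
    calc |a| * M ^ 7 * μ ^ 7 ≤ 1 / 100 * μ ^ 2 := by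
          apply mul_le_mul ha7 h7 (by positivity) (by norm_num)
      _ = μ ^ 2 / 100 := by ring
  have ha5 : |a| * (M * (8 * M ^ 4)) ≤ 8 * μ ^ 2 / 100 := by
    have e : |a| * (M * (8 * M ^ 4)) = 8 * (|a| * M ^ 7) * μ ^ 2 := by
      have : |a| * (M * (8 * M ^ 4)) = 8 * |a| * M ^ 5 * (M * μ) ^ 2 := by rw [hμM]; ring
      rw [this]; ring
    rw [e]
    nlinarith [sq_nonneg μ]
  -- a point at which the upper line is far above the lower line
  obtain ⟨β, hβ⟩ : ∃ β, L * β = b := ⟨b / L, by field_simp⟩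
  have hβ4 : |β| ≤ 2 * M ^ 4 := by
    have h1 : L * |β| ≤ M := by rw [← abs_of_pos hL0, ← abs_mul, hβ]; exact hbM
    have h2 : |β| ≤ 2 * M ^ 3 * L * |β| := le_mul_of_one_le_left (abs_nonneg _) hL
    have h3 : 2 * M ^ 3 * (L * |β|) ≤ 2 * M ^ 3 * M := by gcongr
    nlinarith
  have hβ' := abs_le.mp hβ4
  have hs'K : 2 * M ^ 4 ∈ Set.Icc 0 K := ⟨by positivity, by rw [hK]; linarith⟩
  have hsK : 2 * M ^ 4 + β ∈ Set.Icc 0 K := ⟨by linarith, by rw [hK]; linarith⟩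
  have hfar : 79 / 100 * μ ^ 2 ≤ |F2 (g (2 * M ^ 4, 1))| := by
    have k0 := l0 _ hsK
    have k1 := l1 _ hs'K
    have hdlow := (hg (2 * M ^ 4, 1) (2 * M ^ 4 + β, 0)).1
    have hd1 : 1 ≤ dPar (2 * M ^ 4, 1) (2 * M ^ 4 + β, 0) := by
      simp [dPar]
    have hdμ : μ ≤ dH (g (2 * M ^ 4, 1)) (g (2 * M ^ 4 + β, 0)) := by
      refine le_trans ?_ hdlow
      rw [← hμ]
      exact le_mul_of_one_le_right hμ0.le hd1
    have hF := F2_sub (g (2 * M ^ 4, 1)) (g (2 * M ^ 4 + β, 0))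
    set x := (g (2 * M ^ 4, 1)).1 - (g (2 * M ^ 4 + β, 0)).1 with hx
    set y := (g (2 * M ^ 4, 1)).2.1 - (g (2 * M ^ 4 + β, 0)).2.1 with hy
    have i1 := abs_le.mp k0.1
    have i2 := abs_le.mp k0.2.1
    have i3 := abs_le.mp k1.1
    have i4 := abs_le.mp k1.2.1
    have i5 := abs_le.mp haμ
    have hxb : |x| ≤ 3 * μ ^ 2 / 100 := by
      rw [abs_le]; constructor <;> linarith
    have hyb : |y| ≤ 2 * μ ^ 2 / 100 := by
      have : L * (2 * M ^ 4 + β) = L * (2 * M ^ 4) + b := by rw [mul_add, hβ]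
      rw [this] at i2
      rw [abs_le]; constructor <;> linarith
    have hμ4 : μ ^ 4 ≤ μ ^ 2 := pow_le_pow_of_le_one hμ0.le hμ1 (by norm_num)
    have hxy : x ^ 2 + y ^ 2 ≤ (9 / 10 * μ) ^ 2 := by
      have e1 : x ^ 2 ≤ (3 * μ ^ 2 / 100) ^ 2 := sq_le_sq' (abs_le.mp hxb).1 (abs_le.mp hxb).2
      have e2 : y ^ 2 ≤ (2 * μ ^ 2 / 100) ^ 2 := sq_le_sq' (abs_le.mp hyb).1 (abs_le.mp hyb).2
      have e3 : (3 * μ ^ 2 / 100) ^ 2 + (2 * μ ^ 2 / 100) ^ 2 = 13 / 10000 * μ ^ 4 := by ring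
      have e4 : (9 / 10 * μ) ^ 2 = 81 / 100 * μ ^ 2 := by ring
      have e5 := sq_nonneg μ
      rw [e4]
      linarith
    have htt : (9 / 10 * μ) ^ 2 < |tt (g (2 * M ^ 4 + β, 0)) (g (2 * M ^ 4, 1))| := by
      by_contra hcon
      push Not at hcon
      have := (dH_le_iff (by positivity)).mpr ⟨hxy, hcon⟩
      linarith
    have hp1 : |x * y / 2| ≤ μ ^ 2 / 1000 := by
      rw [abs_div, abs_mul, abs_two]
      have := mul_le_mul hxb hyb (abs_nonneg _) (by positivity)
      have e : 3 * μ ^ 2 / 100 * (2 * μ ^ 2 / 100) = 6 / 10000 * μ ^ 4 := by ring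
      have := sq_nonneg μ
      linarith
    have hp2 : |(g (2 * M ^ 4 + β, 0)).1 * y| ≤ μ ^ 2 / 1000 := by
      rw [abs_mul]
      have := mul_le_mul (k0.1.trans hεμ) hyb (abs_nonneg _) (by positivity)
      have e : μ ^ 2 / 100 * (2 * μ ^ 2 / 100) = 2 / 10000 * μ ^ 4 := by ring
      have := sq_nonneg μ
      linarith
    have j1 := abs_le.mp hp1
    have j2 := abs_le.mp hp2
    have j3 := abs_le.mp k0.2.2
    have e81 : (9 / 10 * μ) ^ 2 = 81 / 100 * μ ^ 2 := by ring
    rw [lt_abs, e81] at htt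
    rw [le_abs]
    rcases htt with h | h
    · left; linarith
    · right; linarith
  have hnear : ∀ s ∈ Set.Icc 0 (8 * M ^ 4),
      |F2 (g (s, 1)) - F2 (g (2 * M ^ 4, 1))| ≤ 10 / 100 * μ ^ 2 := by
    intro s hs
    have k0 := l1 s ⟨hs.1, hs.2.trans (by rw [hK]; linarith)⟩
    have k1 := l1 _ hs'K
    have d := (hg (s, 1) (2 * M ^ 4, 1)).2
    rw [dPar_horiz] at d
    have d2 := dH_Y d
    have d3 : |s - 2 * M ^ 4| ≤ 8 * M ^ 4 := by
      rw [abs_le]; constructor <;> linarith [hs.1, hs.2]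
    have d4 : |a * ((g (s, 1)).2.1 - (g (2 * M ^ 4, 1)).2.1)| ≤ 8 * μ ^ 2 / 100 := by
      rw [abs_mul]
      refine le_trans ?_ ha5
      apply mul_le_mul_of_nonneg_left _ (abs_nonneg a)
      exact d2.trans (mul_le_mul_of_nonneg_left d3 hM0.le)
    have i1 := abs_le.mp k0.2.2
    have i2 := abs_le.mp k1.2.2
    have i3 := abs_le.mp d4
    rw [abs_le]; constructor <;> linarith
  have hbot : ∀ s ∈ Set.Icc 0 (8 * M ^ 4), |F2 (g (s, 0))| ≤ μ ^ 2 / 100 := fun s hs =>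
    (l0 s ⟨hs.1, hs.2.trans (by rw [hK]; linarith)⟩).2.2.trans hεμ
  have hvert : ∀ s, ∀ t ∈ Set.Icc (0:ℝ) 1, |(g (s, t)).2.1 - (g (s, 0)).2.1| ≤ M := by
    intro s t ht
    have := (hg (s, t) (s, 0)).2
    have h2 : dPar (s, t) (s, 0) ≤ 1 := by
      simp only [dPar, sub_self, abs_zero, sub_zero]
      apply max_le zero_le_one
      rw [abs_of_nonneg ht.1]
      exact Real.sqrt_le_one.mpr ht.2
    exact dH_Y (this.trans (mul_le_of_le_one_right hM0.le h2))
  have hleft : ∀ u ∈ Set.Icc (M + 1 / 2) (M + 3 / 2), ∀ t ∈ Set.Icc (0:ℝ) 1,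
      (g (0, t)).2.1 - u < 0 := by
    intro u hu t ht
    have := (abs_le.mp (hvert 0 t ht)).2
    rw [hxy0.2.1] at this
    linarith [hu.1]
  have hright : ∀ u ∈ Set.Icc (M + 1 / 2) (M + 3 / 2), ∀ t ∈ Set.Icc (0:ℝ) 1,
      0 < (g (8 * M ^ 4, t)).2.1 - u := by
    intro u hu t ht
    have h1 := (abs_le.mp (hvert (8 * M ^ 4) t ht)).1
    have h2 := (abs_le.mp (l0 (8 * M ^ 4) ⟨by positivity, by rw [hK]; linarith⟩).2.1).1
    have h3 : 4 * M ≤ L * (8 * M ^ 4) := by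
      have : L * (8 * M ^ 4) = (2 * M ^ 3 * L) * (4 * M) := by ring
      rw [this]
      exact le_mul_of_one_le_left (by positivity) hL
    linarith [hu.2]
  have cY := cont_Y hg
  have cF := cont_F2 hg
  have e8 : 1 / (8 * M ^ 2) = μ ^ 2 / 8 := by rw [hμ]; field_simp
  have hμsq : 0 < μ ^ 2 := by positivity
  rw [e8]
  rcases le_abs.mp hfar with hpos | hneg
  · refine ⟨μ ^ 2 / 8, fun u hu v hv => ?_⟩
    obtain ⟨s, hs, t, ht, e1, e2⟩ := poincare_miranda (fun z => (g z).2.1 - u)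
      (fun z => F2 (g z) - v) (by fun_prop) (by fun_prop) (8 * M ^ 4) (by positivity)
      (hleft u hu) (hright u hu)
      (fun s hs => by
        have := (abs_le.mp (hbot s hs)).2
        have := hv.1
        linarith)
      (fun s hs => by
        have := (abs_le.mp (hnear s hs)).1
        have := hv.2
        linarith)
    exact ⟨s, hs, t, ht, by linarith, by linarith⟩
  · refine ⟨-(μ ^ 2 / 4), fun u hu v hv => ?_⟩
    obtain ⟨s, hs, t, ht, e1, e2⟩ := poincare_miranda (fun z => (g z).2.1 - u)
      (fun z => v - F2 (g z)) (by fun_prop) (by fun_prop) (8 * M ^ 4) (by positivity)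
      (hleft u hu) (hright u hu)
      (fun s hs => by
        have := (abs_le.mp (hbot s hs)).1
        have := hv.2
        linarith)
      (fun s hs => by
        have := (abs_le.mp (hnear s hs)).2
        have := hv.1
        linarith)
    exact ⟨s, hs, t, ht, by linarith, by linarith⟩

/-- Heisenberg dilation. -/
noncomputable def dil (c : ℝ) (p : Hei) : Hei := (c * p.1, c * p.2.1, c ^ 2 * p.2.2)

lemma dH_eq (p q : Hei) : dH p q =
    max (Real.sqrt ((p.1 - q.1) ^ 2 + (p.2.1 - q.2.1) ^ 2)) (Real.sqrt |tt q p|) := by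
  unfold dH Hnorm Hmul Hinv tt
  simp only []
  have e1 : (-q.1 + p.1) ^ 2 + (-q.2.1 + p.2.1) ^ 2 =
    (p.1 - q.1) ^ 2 + (p.2.1 - q.2.1) ^ 2 := by ring
  have e2 : -q.2.2 + p.2.2 + (-q.1 * p.2.1 - p.1 * -q.2.1) / 2 =
    p.2.2 - q.2.2 + (q.2.1 * p.1 - q.1 * p.2.1) / 2 := by ring
  rw [e1, e2]

lemma dH_left (a p q : Hei) : dH (Hmul a p) (Hmul a q) = dH p q := by
  rw [dH_eq, dH_eq]
  have e1 : ((Hmul a p).1 - (Hmul a q).1) ^ 2 + ((Hmul a p).2.1 - (Hmul a q).2.1) ^ 2 =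
      (p.1 - q.1) ^ 2 + (p.2.1 - q.2.1) ^ 2 := by simp only [Hmul]; ring
  have e2 : tt (Hmul a q) (Hmul a p) = tt q p := by simp only [Hmul, tt]; ring
  rw [e1, e2]

lemma dH_rot (θ : ℝ) (p q : Hei) : dH (Rrot θ p) (Rrot θ q) = dH p q := by
  rw [dH_eq, dH_eq]
  have h := Real.sin_sq_add_cos_sq θ
  have e1 : ((Rrot θ p).1 - (Rrot θ q).1) ^ 2 + ((Rrot θ p).2.1 - (Rrot θ q).2.1) ^ 2 =
      (p.1 - q.1) ^ 2 + (p.2.1 - q.2.1) ^ 2 := by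
    simp only [Rrot]
    linear_combination ((p.1 - q.1) ^ 2 + (p.2.1 - q.2.1) ^ 2) * h
  have e2 : tt (Rrot θ q) (Rrot θ p) = tt q p := by
    simp only [Rrot, tt]
    linear_combination ((q.2.1 * p.1 - q.1 * p.2.1) / 2) * h
  rw [e1, e2]

lemma dH_dil {c : ℝ} (hc : 0 ≤ c) (p q : Hei) : dH (dil c p) (dil c q) = c * dH p q := by
  rw [dH_eq, dH_eq, mul_max_of_nonneg _ _ hc]
  have e1 : ((dil c p).1 - (dil c q).1) ^ 2 + ((dil c p).2.1 - (dil c q).2.1) ^ 2 =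
      c ^ 2 * ((p.1 - q.1) ^ 2 + (p.2.1 - q.2.1) ^ 2) := by simp only [dil]; ring
  have e2 : |tt (dil c q) (dil c p)| = c ^ 2 * |tt q p| := by
    have : tt (dil c q) (dil c p) = c ^ 2 * tt q p := by simp only [dil, tt]; ring
    rw [this, abs_mul, abs_of_nonneg (sq_nonneg c)]
  rw [e1, e2, Real.sqrt_mul (sq_nonneg c), Real.sqrt_mul (sq_nonneg c), Real.sqrt_sq hc]

/-- Rescaling of the parameter domain. -/
def rescW (w0 : ℝ × ℝ) (ρ s : ℝ) (v : ℝ × ℝ) : ℝ × ℝ := (w0.1 + ρ * v.1, w0.2 + s * ρ ^ 2 * v.2)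

lemma dPar_resc (w0 : ℝ × ℝ) {ρ s : ℝ} (hρ : 0 ≤ ρ) (hs : |s| = 1) (v w : ℝ × ℝ) :
    dPar (rescW w0 ρ s v) (rescW w0 ρ s w) = ρ * dPar v w := by
  unfold dPar rescW
  rw [mul_max_of_nonneg _ _ hρ]
  congr 1
  · rw [show w0.1 + ρ * v.1 - (w0.1 + ρ * w.1) = ρ * (v.1 - w.1) by ring, abs_mul,
      abs_of_nonneg hρ]
  · rw [show w0.2 + s * ρ ^ 2 * v.2 - (w0.2 + s * ρ ^ 2 * w.2) = s * (ρ ^ 2 * (v.2 - w.2)) by ring,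
      abs_mul, hs, one_mul, abs_mul, abs_of_nonneg (sq_nonneg ρ), Real.sqrt_mul (sq_nonneg ρ),
      Real.sqrt_sq hρ]

/-- Rescaled, rotated and translated map. -/
noncomputable def resc (f : ℝ × ℝ → Hei) (w0 : ℝ × ℝ) (ρ s φ : ℝ) (v : ℝ × ℝ) : Hei :=
  dil ρ⁻¹ (Rrot (-φ) (Hmul (Hinv (f w0)) (f (rescW w0 ρ s v))))

lemma resc_bilip {f : ℝ × ℝ → Hei} {M : ℝ} (hf : IsBilipschitz M f) (w0 : ℝ × ℝ) {ρ s : ℝ}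
    (φ : ℝ) (hρ : 0 < ρ) (hs : |s| = 1) : IsBilipschitz M (resc f w0 ρ s φ) := by
  intro v w
  have h := hf (rescW w0 ρ s v) (rescW w0 ρ s w)
  rw [dPar_resc w0 hρ.le hs] at h
  unfold resc
  rw [dH_dil (by positivity), dH_rot, dH_left]
  constructor
  · have := mul_le_mul_of_nonneg_left h.1 (inv_nonneg.mpr hρ.le)
    refine le_trans (le_of_eq ?_) this
    field_simp
  · have := mul_le_mul_of_nonneg_left h.2 (inv_nonneg.mpr hρ.le)
    refine le_trans this (le_of_eq ?_)
    field_simp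

lemma Rrot_Rrot (a b : ℝ) (p : Hei) : Rrot a (Rrot b p) = Rrot (a + b) p := by
  simp only [Rrot, Real.cos_add, Real.sin_add]
  refine Prod.ext ?_ (Prod.ext ?_ rfl)
  · simp only; ring
  · simp only; ring

lemma Rrot_dil (a c : ℝ) (p : Hei) : Rrot a (dil c p) = dil c (Rrot a p) := by
  simp only [Rrot, dil]
  refine Prod.ext ?_ (Prod.ext ?_ rfl)
  · simp only; ring
  · simp only; ring

lemma Rrot_rel (a : ℝ) (p q : Hei) :
    Rrot a (Hmul (Hinv p) q) = Hmul (Hinv (Rrot a p)) (Rrot a q) := by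
  have h := Real.sin_sq_add_cos_sq a
  simp only [Rrot, Hmul, Hinv]
  refine Prod.ext ?_ (Prod.ext ?_ ?_)
  · simp only; ring
  · simp only; ring
  · simp only
    linear_combination (-(-p.1 * q.2.1 - q.1 * -p.2.1) / 2) * h

lemma F2_dil (c : ℝ) (p : Hei) : F2 (dil c p) = c ^ 2 * F2 p := by
  simp only [F2, dil]; ring

/-- The projection in direction `θ` of `A` contains a sheared box. -/
def HasBox (θ : ℝ) (A : Set Hei) (α β : ℝ) : Prop :=
  ∃ u0 v0 k : ℝ, ∀ u ∈ Set.Icc u0 (u0 + α), ∀ v ∈ Set.Icc v0 (v0 + β),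
    ∃ p ∈ A, (Rrot (-θ) p).2.1 = u ∧ F2 (Rrot (-θ) p) = v + k * u

lemma hasBox_resc {f : ℝ × ℝ → Hei} (w0 : ℝ × ℝ) {ρ s : ℝ} (φ θ : ℝ) (hρ : 0 < ρ)
    {S T : Set (ℝ × ℝ)} (hST : ∀ v ∈ S, rescW w0 ρ s v ∈ T) {α β : ℝ}
    (h : HasBox θ (resc f w0 ρ s φ '' S) α β) :
    HasBox (θ + φ) (f '' T) (ρ * α) (ρ ^ 2 * β) := by
  obtain ⟨u0, v0, k, h⟩ := h
  set P := Rrot (-(θ + φ)) (f w0) with hP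
  refine ⟨P.2.1 + ρ * u0, ρ ^ 2 * v0 + F2 P - (k * ρ + P.1) * P.2.1, k * ρ + P.1, ?_⟩
  intro u hu v hv
  obtain ⟨p, ⟨z, hz, rfl⟩, e1, e2⟩ := h (ρ⁻¹ * (u - P.2.1))
    ⟨by rw [inv_mul_eq_div, le_div_iff₀ hρ]; linarith [hu.1],
     by rw [inv_mul_eq_div, div_le_iff₀ hρ]; linarith [hu.2]⟩
    ((ρ ^ 2)⁻¹ * (v - F2 P + (k * ρ + P.1) * P.2.1))
    ⟨by rw [inv_mul_eq_div, le_div_iff₀ (by positivity)]; linarith [hv.1],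
     by rw [inv_mul_eq_div, div_le_iff₀ (by positivity)]; linarith [hv.2]⟩
  have key : Rrot (-θ) (resc f w0 ρ s φ z) =
      dil ρ⁻¹ (Hmul (Hinv P) (Rrot (-(θ + φ)) (f (rescW w0 ρ s z)))) := by
    unfold resc
    rw [Rrot_dil, Rrot_Rrot, ← neg_add, Rrot_rel]
  refine ⟨f (rescW w0 ρ s z), ⟨_, hST z hz, rfl⟩, ?_⟩
  set Q := Rrot (-(θ + φ)) (f (rescW w0 ρ s z)) with hQ
  rw [key] at e1 e2
  rw [F2_dil, F2_rel] at e2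
  simp only [dil, Hmul, Hinv] at e1
  have e1' : Q.2.1 = u := by
    have := mul_left_cancel₀ (inv_ne_zero hρ.ne') e1
    linarith
  refine ⟨e1', ?_⟩
  rw [e1'] at e2
  have hρ2 : ρ ^ 2 ≠ 0 := by positivity
  field_simp at e2
  linarith

open MeasureTheory in
lemma vol_shear (u0 v0 k α β : ℝ) (hα : 0 ≤ α) (S : Set (ℝ × ℝ))
    (hS : ∀ u ∈ Set.Icc u0 (u0 + α), ∀ v ∈ Set.Icc v0 (v0 + β), (u, v + k * u) ∈ S) :
    ENNReal.ofReal (α * β) ≤ volume S := by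
  let B : Set (ℝ × ℝ) := {z | z.1 ∈ Set.Icc u0 (u0 + α) ∧ z.2 - k * z.1 ∈ Set.Icc v0 (v0 + β)}
  have hB : MeasurableSet B := by
    apply MeasurableSet.inter
    · exact measurable_fst measurableSet_Icc
    · exact (show Measurable fun z : ℝ × ℝ => z.2 - k * z.1 by fun_prop) measurableSet_Icc
  have hBS : B ⊆ S := by
    rintro ⟨u, v⟩ ⟨h1, h2⟩
    have := hS u h1 _ h2
    simpa using this
  refine le_trans ?_ (measure_mono hBS)
  rw [Measure.volume_eq_prod, Measure.prod_apply hB]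
  calc ENNReal.ofReal (α * β) = ∫⁻ x in Set.Icc u0 (u0 + α), ENNReal.ofReal β := by
        rw [lintegral_const, Measure.restrict_apply_univ, Real.volume_Icc, ENNReal.ofReal_mul hα,
          mul_comm]
        congr 2; ring
    _ ≤ ∫⁻ x in Set.Icc u0 (u0 + α), volume (Prod.mk x ⁻¹' B) := by
        refine setLIntegral_mono' measurableSet_Icc fun x hx => ?_
        have : Set.Icc (v0 + k * x) (v0 + k * x + β) ⊆ Prod.mk x ⁻¹' B := by
          intro y hy
          exact ⟨hx, by simp only [Set.mem_Icc]; constructor <;> linarith [hy.1, hy.2]⟩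
        refine le_trans (le_of_eq ?_) (measure_mono this)
        rw [Real.volume_Icc]; congr 1; ring
    _ ≤ _ := setLIntegral_le_lintegral _ _

open MeasureTheory in
lemma vol_le_H3 (θ : ℝ) (E : Set Hei) (S : Set (ℝ × ℝ))
    (hS : ∀ z ∈ S, Rrot θ (embedW z) ∈ E) : volume S ≤ H3 E := by
  unfold H3
  refine le_iSup₂_of_le ⊤ ENNReal.coe_lt_top ?_
  refine le_iInf fun U => le_iInf fun hU => le_iInf fun _ => ?_
  let V : ℕ → Set (ℝ × ℝ) := fun n => {z | Rrot θ (embedW z) ∈ U n}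
  have hSV : S ⊆ ⋃ n, V n := by
    intro z hz
    obtain ⟨n, hn⟩ := Set.mem_iUnion.mp (hU (hS z hz))
    exact Set.mem_iUnion.mpr ⟨n, hn⟩
  refine (measure_mono hSV).trans ((measure_iUnion_le V).trans (ENNReal.tsum_le_tsum fun n => ?_))
  have hd : ∀ z ∈ V n, ∀ z' ∈ V n, ENNReal.ofReal (dPar z z') ≤ ediamH (U n) := by
    intro z hz z' hz'
    have : dPar z z' = dH (Rrot θ (embedW z)) (Rrot θ (embedW z')) := by
      rw [dH_rot, dH_eq]
      simp only [embedW, tt, dPar]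
      congr 2
      · simp [Real.sqrt_sq_eq_abs]
      · congr 1; ring
    rw [this]
    unfold ediamH
    exact le_iSup₂_of_le _ hz (le_iSup₂_of_le (f := fun q _ => ENNReal.ofReal
      (dH (Rrot θ (embedW z)) q)) _ hz' le_rfl)
  have h1 : volume (Prod.fst '' V n) ≤ ediamH (U n) := by
    refine (Real.volume_le_diam _).trans (Metric.ediam_le ?_)
    rintro _ ⟨z, hz, rfl⟩ _ ⟨z', hz', rfl⟩
    refine le_trans ?_ (hd z hz z' hz')
    rw [edist_dist, Real.dist_eq]
    exact ENNReal.ofReal_le_ofReal (le_max_left _ _)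
  have h2 : volume (Prod.snd '' V n) ≤ ediamH (U n) ^ 2 := by
    refine (Real.volume_le_diam _).trans (Metric.ediam_le ?_)
    rintro _ ⟨z, hz, rfl⟩ _ ⟨z', hz', rfl⟩
    refine le_trans ?_ (pow_le_pow_left₀ (zero_le) (hd z hz z' hz') 2)
    rw [edist_dist, Real.dist_eq, ← ENNReal.ofReal_pow (dPar_nonneg _ _)]
    apply ENNReal.ofReal_le_ofReal
    rw [← Real.sq_sqrt (abs_nonneg (z.2 - z'.2))]
    exact pow_le_pow_left₀ (Real.sqrt_nonneg _) (le_max_right _ _) 2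
  calc volume (V n) ≤ volume ((Prod.fst '' V n) ×ˢ (Prod.snd '' V n)) :=
        measure_mono fun z hz => ⟨⟨z, hz, rfl⟩, ⟨z, hz, rfl⟩⟩
    _ = volume (Prod.fst '' V n) * volume (Prod.snd '' V n) := by
        rw [Measure.volume_eq_prod, Measure.prod_prod]
    _ ≤ ediamH (U n) * ediamH (U n) ^ 2 := by gcongr
    _ = ediamH (U n) ^ 3 := by ring

lemma hasBox_H3 {θ : ℝ} {A : Set Hei} {α β : ℝ} (hα : 0 ≤ α) (h : HasBox θ A α β) :
    ENNReal.ofReal (α * β) ≤ H3 (PiTheta θ '' A) := by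
  obtain ⟨u0, v0, k, h⟩ := h
  let S : Set (ℝ × ℝ) := {z | Rrot θ (embedW z) ∈ PiTheta θ '' A}
  refine (vol_shear u0 v0 k α β hα S ?_).trans (vol_le_H3 θ _ S fun z hz => hz)
  intro u hu v hv
  obtain ⟨p, hp, e1, e2⟩ := h u hu v hv
  refine ⟨p, hp, ?_⟩
  simp only [PiTheta]
  congr 1
  simp only [Piproj, embedW]
  rw [e1]
  unfold F2 at e2
  rw [e1] at e2
  rw [e2]

lemma PiTheta_pi (θ : ℝ) : PiTheta (θ + Real.pi) = PiTheta θ := by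
  funext p
  simp only [PiTheta, Rrot, Piproj, Real.cos_neg, Real.sin_neg, Real.cos_add_pi, Real.sin_add_pi]
  refine Prod.ext ?_ (Prod.ext ?_ ?_) <;> simp only <;> ring

lemma PiTheta_mod (θ : ℝ) : ∃ θ' ∈ Set.Ico (-(Real.pi / 2)) (Real.pi / 2),
    PiTheta θ' = PiTheta θ := by
  have hper : Function.Periodic PiTheta Real.pi := PiTheta_pi
  refine ⟨toIcoMod Real.pi_pos (-(Real.pi / 2)) θ, ?_, ?_⟩
  · have := toIcoMod_mem_Ico Real.pi_pos (-(Real.pi / 2)) θ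
    rwa [show -(Real.pi / 2) + Real.pi = Real.pi / 2 by ring] at this
  · rw [toIcoMod]
    exact hper.sub_zsmul_eq _

/-- Horizontal chord length. -/
noncomputable def chord (f : ℝ × ℝ → Hei) (t a b : ℝ) : ℝ :=
  Real.sqrt (((f (b, t)).1 - (f (a, t)).1) ^ 2 + ((f (b, t)).2.1 - (f (a, t)).2.1) ^ 2)

lemma chord_nonneg (f : ℝ × ℝ → Hei) (t a b : ℝ) : 0 ≤ chord f t a b := Real.sqrt_nonneg _

lemma chord_sq (f : ℝ × ℝ → Hei) (t a b : ℝ) : chord f t a b ^ 2 =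
    ((f (b, t)).1 - (f (a, t)).1) ^ 2 + ((f (b, t)).2.1 - (f (a, t)).2.1) ^ 2 :=
  Real.sq_sqrt (by positivity)

lemma chord_le {f : ℝ × ℝ → Hei} {M : ℝ} (hf : IsBilipschitz M f) (t : ℝ) {a b : ℝ}
    (hab : a ≤ b) : chord f t a b ≤ M * (b - a) := by
  have h := (hf (b, t) (a, t)).2
  rw [dPar_horiz, abs_of_nonneg (by linarith)] at h
  refine le_trans ?_ h
  rw [dH_eq]
  exact le_max_left _ _

lemma start_pair {f : ℝ × ℝ → Hei} {M c : ℝ} (hM : 1 ≤ M) (hf : IsBilipschitz M f)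
    (hc : c * (2 * M ^ 3) = 1) :
    ∃ b, c / M ≤ b ∧ b ≤ 1 ∧ c * b ≤ chord f 0 0 b := by
  have hM0 : 0 < M := by linarith
  have hM3 : 1 ≤ M ^ 3 := one_le_pow₀ hM
  have hM2 : 1 ≤ M ^ 2 := one_le_pow₀ hM
  have hc0 : 0 < c := by
    by_contra h
    push Not at h
    nlinarith
  have hcM : c * M ≤ 1 / 2 * (1 / M) ^ 2 := by
    have : c = 1 / (2 * M ^ 3) := by field_simp; linarith
    rw [this]; apply le_of_eq; field_simp
  have hcM2 : c ≤ 1 / 2 * (1 / M) := by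
    rw [mul_one_div, le_div_iff₀ hM0]
    nlinarith
  by_contra hcon
  push Not at hcon
  set γ : ℝ → Hei := fun s => Hmul (Hinv (f (0, 0))) (f (s, 0)) with hγ
  have hX : ∀ s, (γ s).1 = (f (s, 0)).1 - (f (0, 0)).1 := by
    intro s; simp only [hγ, Hmul, Hinv]; ring
  have hY : ∀ s, (γ s).2.1 = (f (s, 0)).2.1 - (f (0, 0)).2.1 := by
    intro s; simp only [hγ, Hmul, Hinv]; ring
  have hLip : ∀ s s', dH (γ s) (γ s') ≤ M * |s - s'| := by
    intro s s'
    simp only [hγ]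
    rw [dH_left, ← dPar_horiz s s' 0]
    exact (hf _ _).2
  have h1 := area_lemma γ M 1 c hM0.le zero_le_one
    (by simp only [hγ, Hmul, Hinv]; refine Prod.ext ?_ (Prod.ext ?_ ?_) <;> simp only <;> ring)
    hLip (by
      intro s hs
      rcases lt_or_ge s (c / M) with h | h
      · have h2 := dH_X (hf (s, 0) (0, 0)).2
        rw [dPar_horiz, sub_zero, abs_of_nonneg hs.1, ← hX] at h2
        rw [lt_div_iff₀ hM0] at h
        linarith
      · have h2 := hcon s h hs.2
        have h3 := chord_sq f 0 0 s
        rw [← hX, ← hY] at h3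
        have h4 := chord_nonneg f 0 0 s
        apply abs_le_of_sq_le_sq _ hc0.le
        have : chord f 0 0 s ≤ c := by nlinarith [hs.2]
        nlinarith [sq_nonneg (γ s).2.1])
  have h2 := hcon 1 (by rw [div_le_one hM0]; nlinarith [show (1 / M) ≤ 1 by rw [div_le_one hM0]; exact hM]) le_rfl
  have h3 := chord_sq f 0 0 1
  have h4 := chord_nonneg f 0 0 1
  have h5 : chord f 0 0 1 ^ 2 ≤ c ^ 2 := by nlinarith
  have h6 := (hf (1, 0) (0, 0)).1
  rw [dPar_horiz] at h6
  have hiM : 0 < 1 / M := by positivity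
  have hcsq : c ^ 2 ≤ 1 / 4 * (1 / M) ^ 2 := by nlinarith
  have h7 : dH (f (1, 0)) (f (0, 0)) ≤ 9 / 10 * (1 / M) := by
    rw [dH_le_iff (by positivity)]
    constructor
    · nlinarith
    · have e : tt (f (0, 0)) (f (1, 0)) = F2 (γ 1) - (γ 1).1 * (γ 1).2.1 / 2 := by
        simp only [hγ, F2, tt, Hmul, Hinv]; ring
      rw [← hX, ← hY] at h3
      rw [e]
      have := abs_le.mp h1
      rw [abs_le]
      constructor <;> nlinarith [sq_nonneg ((γ 1).1 - (γ 1).2.1), sq_nonneg ((γ 1).1 + (γ 1).2.1)]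
  norm_num at h6 h7
  have : 0 < M⁻¹ := by positivity
  linarith

lemma selection {α : Type*} (P : α → Prop) (ℓ R : α → ℝ) (M lam e : ℝ) (hl : 0 < lam)
    (hl1 : lam ≤ 1) (hℓ : ∀ x, P x → 0 ≤ ℓ x) (hR : ∀ x, P x → R x ≤ M) :
    ∀ (n : ℕ) (x : α), P x → M < R x + n * e →
      ∃ y, P y ∧ R x ≤ R y ∧ lam ^ n * ℓ x ≤ ℓ y ∧
        ∀ z, P z → lam * ℓ y ≤ ℓ z → R z ≤ R y + e := by
  intro n
  induction n with
  | zero =>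
    intro x hx h
    have := hR x hx
    simp at h
    linarith
  | succ n ih =>
    intro x hx h
    by_cases hgood : (∀ z, P z → lam * ℓ x ≤ ℓ z → R z ≤ R x + e)
    · refine ⟨x, hx, le_rfl, ?_, hgood⟩
      have := pow_le_one₀ (n := n + 1) hl.le hl1
      nlinarith [hℓ x hx]
    · push Not at hgood
      obtain ⟨z, hz, h1, h2⟩ := hgood
      by_cases he : 0 ≤ e
      · push_cast at h
        obtain ⟨y, hy, h3, h4, h5⟩ := ih z hz (by nlinarith)
        refine ⟨y, hy, by linarith, ?_, h5⟩
        rw [pow_succ, mul_assoc]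
        exact (mul_le_mul_of_nonneg_left h1 (by positivity)).trans h4
      · exfalso
        have := hR x hx
        push_cast at h
        push Not at he
        nlinarith [show (0:ℝ) ≤ n from Nat.cast_nonneg n]

lemma pigeon (D : ℕ → ℝ) (n : ℕ) (B : ℝ) (hn : 0 < n) (h : D n - D 0 ≤ n * B) :
    ∃ i < n, D (i + 1) - D i ≤ B := by
  by_contra hcon
  push Not at hcon
  have : ∑ i ∈ Finset.range n, B < ∑ i ∈ Finset.range n, (D (i + 1) - D i) := by
    apply Finset.sum_lt_sum_of_nonempty
    · simpa using hn.ne'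
    · intro i hi; exact hcon i (Finset.mem_range.mp hi)
  rw [Finset.sum_range_sub] at this
  simp at this
  linarith

lemma exists_angle (dx dy : ℝ) : ∃ φ : ℝ,
    dx * Real.sin (-φ) + dy * Real.cos (-φ) = Real.sqrt (dx ^ 2 + dy ^ 2) := by
  set z : ℂ := ⟨dy, -dx⟩ with hz
  have hn : ‖z‖ = Real.sqrt (dx ^ 2 + dy ^ 2) := by
    rw [Complex.norm_def, Complex.normSq_apply]
    congr 1; simp only [hz]; ring
  refine ⟨z.arg, ?_⟩
  rw [← hn, Real.sin_neg, Real.cos_neg]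
  have h1 : ‖z‖ * Real.cos z.arg = dy := Complex.norm_mul_cos_arg z
  have h2 : ‖z‖ * Real.sin z.arg = -dx := Complex.norm_mul_sin_arg z
  have h3 := Real.sin_sq_add_cos_sq z.arg
  linear_combination (-Real.sin z.arg) * h2 - Real.cos z.arg * h1 + ‖z‖ * h3

/-- Rotated second coordinate. -/
noncomputable def Yf (f : ℝ × ℝ → Hei) (φ : ℝ) (v : ℝ × ℝ) : ℝ := (Rrot (-φ) (f v)).2.1

lemma Yf_le_chord (f : ℝ × ℝ → Hei) (φ t a b : ℝ) :
    Yf f φ (b, t) - Yf f φ (a, t) ≤ chord f t a b := by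
  apply le_trans (le_abs_self _)
  apply abs_le_of_sq_le_sq _ (chord_nonneg _ _ _ _)
  rw [chord_sq]
  simp only [Yf, Rrot]
  have h := Real.sin_sq_add_cos_sq (-φ)
  set S := Real.sin (-φ)
  set C := Real.cos (-φ)
  set x := (f (b, t)).1 - (f (a, t)).1 with hx
  set y := (f (b, t)).2.1 - (f (a, t)).2.1 with hy
  have : (f (b, t)).1 * S + (f (b, t)).2.1 * C - ((f (a, t)).1 * S + (f (a, t)).2.1 * C) =
    x * S + y * C := by rw [hx, hy]; ring
  rw [this]
  have e : x ^ 2 + y ^ 2 = (x * S + y * C) ^ 2 + (x * C - y * S) ^ 2 := by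
    linear_combination (-(x ^ 2 + y ^ 2)) * h
  rw [e]; nlinarith [sq_nonneg (x * C - y * S)]

lemma line_straight {f : ℝ × ℝ → Hei} {M : ℝ} (hM : 1 ≤ M) (hf : IsBilipschitz M f)
    (w0 : ℝ × ℝ) {ρ s : ℝ} (φ : ℝ) (hρ : 0 < ρ) (hs : |s| = 1) (j t' : ℝ)
    (ht' : t' = w0.2 + s * ρ ^ 2 * j) (K L ξ η σ ε : ℝ) (h1 : 1 ≤ K) (h2 : 0 ≤ L)
    (h3 : L ≤ 2 * M) (h4 : 0 ≤ ξ) (h5 : 0 ≤ η) (h6 : 0 < σ) (h7 : σ ≤ K)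
    (h8 : 4 * M * K * η ≤ ξ ^ 2) (h9 : η ≤ ξ) (h10 : (ξ + 3 * M * σ) * M * K ≤ ε)
    (hch : ∀ a b, w0.1 ≤ a → b ≤ w0.1 + K * ρ → σ * ρ ≤ b - a → chord f t' a b ≤ L * (b - a))
    (hend : L * (K * ρ) - η * ρ ≤ Yf f φ (w0.1 + K * ρ, t') - Yf f φ (w0.1, t')) :
    Straight L K ε
      (fun y => Hmul (Hinv (resc f w0 ρ s φ (0, j))) (resc f w0 ρ s φ (y, j))) := by
  have hg := resc_bilip hf w0 φ hρ hs
  have hrw : ∀ y, rescW w0 ρ s (y, j) = (w0.1 + ρ * y, t') := by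
    intro y; simp only [rescW, ht']
  have hgx : ∀ y, (resc f w0 ρ s φ (y, j)).1 =
      ρ⁻¹ * (Rrot (-φ) (Hmul (Hinv (f w0)) (f (w0.1 + ρ * y, t')))).1 := by
    intro y; simp only [resc, hrw, dil]
  have hgy : ∀ y, (resc f w0 ρ s φ (y, j)).2.1 =
      ρ⁻¹ * (Rrot (-φ) (Hmul (Hinv (f w0)) (f (w0.1 + ρ * y, t')))).2.1 := by
    intro y; simp only [resc, hrw, dil]
  apply straighten _ M K L ξ η σ ε hM h1 h2 h3 h4 h5 h6 h7 h8 h9 h10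
  · simp only [Hmul, Hinv]; refine Prod.ext ?_ (Prod.ext ?_ ?_) <;> simp only <;> ring
  · intro y y'
    rw [dH_left, ← dPar_horiz y y' j]
    exact (hg _ _).2
  · intro y y' hy hy' hyy
    have hc := hch (w0.1 + ρ * y) (w0.1 + ρ * y') (by nlinarith) (by nlinarith) (by nlinarith)
    have hc2 := chord_sq f t' (w0.1 + ρ * y) (w0.1 + ρ * y')
    have hc0 := chord_nonneg f t' (w0.1 + ρ * y) (w0.1 + ρ * y')
    have hc3 := pow_le_pow_left₀ hc0 hc 2
    rw [hc2] at hc3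
    simp only [Hmul, Hinv, hgx, hgy, Rrot]
    have h := Real.sin_sq_add_cos_sq (-φ)
    set S := Real.sin (-φ)
    set C := Real.cos (-φ)
    set p := f (w0.1 + ρ * y', t')
    set q := f (w0.1 + ρ * y, t')
    have := mul_le_mul_of_nonneg_left hc3 (show 0 ≤ (ρ⁻¹) ^ 2 by positivity)
    have e : ρ⁻¹ ^ 2 * (L * (w0.1 + ρ * y' - (w0.1 + ρ * y))) ^ 2 = (L * (y' - y)) ^ 2 := by
      field_simp; ring
    rw [e] at this
    refine le_trans (le_of_eq ?_) this
    linear_combination (ρ⁻¹ ^ 2 * ((p.1 - q.1) ^ 2 + (p.2.1 - q.2.1) ^ 2)) * h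
  · simp only [Hmul, Hinv, hgy, Rrot]
    simp only [Yf, Rrot] at hend
    rw [mul_zero, add_zero, mul_comm ρ K]
    set S := Real.sin (-φ)
    set C := Real.cos (-φ)
    set p := f (w0.1 + K * ρ, t')
    set q := f (w0.1, t')
    have := mul_le_mul_of_nonneg_left hend (show 0 ≤ ρ⁻¹ by positivity)
    have e : ρ⁻¹ * (L * (K * ρ) - η * ρ) = L * K - η := by field_simp
    rw [e] at this
    refine le_trans this (le_of_eq ?_)
    ring

/-- Numerical parameters. -/
lemma params (M : ℝ) (hM : 1 ≤ M) : ∃ K ε ξ σ η : ℝ, K = 2000 * M ^ 12 ∧ 0 ≤ ε ∧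
    ε * M ^ 2 ≤ 1 / 100 ∧ 0 ≤ ξ ∧ 0 < η ∧ 0 < σ ∧ σ ≤ 1 ∧ 4 * M * K * η ≤ ξ ^ 2 ∧ η ≤ ξ ∧
    η ≤ 1 ∧ (ξ + 3 * M * σ) * M * K ≤ ε := by
  have hM0 : 0 < M := by linarith
  have hM12 : 1 ≤ M ^ 12 := one_le_pow₀ hM
  have hM2 : 1 ≤ M ^ 2 := one_le_pow₀ hM
  obtain ⟨K, hK⟩ : ∃ K, K = 2000 * M ^ 12 := ⟨_, rfl⟩
  have hK1 : 1 ≤ K := by linarith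
  have hK0 : 0 < K := by linarith
  obtain ⟨ε, hε⟩ : ∃ ε, ε = 1 / (100 * M ^ 2) := ⟨_, rfl⟩
  have hε0 : 0 < ε := by rw [hε]; positivity
  have hε1 : ε ≤ 1 := by rw [hε, div_le_one (by positivity)]; linarith
  obtain ⟨ξ, hξ⟩ : ∃ ξ, ξ = ε / (2 * M * K) := ⟨_, rfl⟩
  have hξ0 : 0 < ξ := by rw [hξ]; positivity
  have hMK : 1 ≤ M * K := one_le_mul_of_one_le_of_one_le hM hK1
  have hξ1 : ξ ≤ 1 := by rw [hξ, div_le_one (by positivity)]; nlinarith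
  have hη : ξ ^ 2 / (4 * M * K) ≤ ξ := by
    rw [div_le_iff₀ (by positivity)]; nlinarith
  refine ⟨K, ε, ξ, ε / (6 * M ^ 2 * K), ξ ^ 2 / (4 * M * K), hK, hε0.le, ?_, hξ0.le,
    by positivity, by positivity, ?_, ?_, hη, hη.trans hξ1, ?_⟩
  · rw [hε]; apply le_of_eq; field_simp
  · rw [div_le_one (by positivity)]; nlinarith
  · apply le_of_eq; field_simp
  · rw [hξ]; apply le_of_eq; field_simp; norm_num

set_option maxHeartbeats 4000000 in
lemma box_exists (M : ℝ) (hM : 1 ≤ M) : ∃ ρ0 > (0 : ℝ), ∀ f : ℝ × ℝ → Hei, IsBilipschitz M f →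
    ∃ θ ρ : ℝ, ρ0 ≤ ρ ∧
      HasBox θ (f '' (Set.Icc 0 1 ×ˢ Set.Icc 0 1)) (ρ * 1) (ρ ^ 2 * (1 / (8 * M ^ 2))) := by
  obtain ⟨K, ε, ξ, σ, η, hK, hε0, hε, hξ0, hη0, hσ0, hσ1, h8, h9, hη1, h10⟩ := params M hM
  have hM0 : 0 < M := by linarith
  have hM12 : 1 ≤ M ^ 12 := one_le_pow₀ hM
  have hK2 : 2000 ≤ K := by linarith
  have hK0 : 0 < K := by linarith
  have hKM : 8 * M ^ 4 ≤ K := by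
    have : M ^ 4 ≤ M ^ 12 := pow_le_pow_right₀ hM (by norm_num)
    linarith
  obtain ⟨n, hn⟩ := exists_nat_ge (4 * M / η)
  have hn' : 4 * M ≤ n * η := by rwa [div_le_iff₀ hη0] at hn
  have hn0 : (0 : ℝ) < n := lt_of_lt_of_le (by positivity) hn
  have hn1 : (1 : ℝ) ≤ n := by nlinarith
  have hnN : 0 < n := by exact_mod_cast hn0
  obtain ⟨e, he⟩ : ∃ e, e = η / (4 * K) := ⟨_, rfl⟩
  have he0 : 0 < e := by rw [he]; positivity
  have heK : e * (4 * K) = η := by rw [he]; field_simp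
  have he1 : e ≤ 1 := by nlinarith
  obtain ⟨lam, hlam⟩ : ∃ l, l = σ / (n * K) := ⟨_, rfl⟩
  have hnK : 2000 ≤ n * K := by nlinarith
  have hl0 : 0 < lam := by rw [hlam]; positivity
  have hl1 : lam ≤ 1 := by rw [hlam, div_le_one (by positivity)]; linarith
  obtain ⟨J, hJ⟩ := exists_nat_gt (M / e)
  rw [div_lt_iff₀ he0] at hJ
  obtain ⟨c, hc⟩ : ∃ c, c = 1 / (2 * M ^ 3) := ⟨_, rfl⟩
  have hc0 : 0 < c := by rw [hc]; positivity
  have hc1 : c * (2 * M ^ 3) = 1 := by rw [hc]; field_simp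
  refine ⟨lam ^ J * (c / M) / (n * K), by positivity, ?_⟩
  intro f hf
  obtain ⟨b0, hb0, hb1, hb2⟩ := start_pair hM hf hc1
  have hb00 : 0 < b0 := lt_of_lt_of_le (by positivity) hb0
  obtain ⟨⟨t, a, b⟩, ⟨⟨ht0, ht1⟩, ha, hab, hb⟩, hR, hℓ, hmax⟩ :=
    selection (α := ℝ × ℝ × ℝ)
    (fun x => x.1 ∈ Set.Icc (0 : ℝ) 1 ∧ 0 ≤ x.2.1 ∧ x.2.1 < x.2.2 ∧ x.2.2 ≤ 1)
    (fun x => x.2.2 - x.2.1) (fun x => chord f x.1 x.2.1 x.2.2 / (x.2.2 - x.2.1))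
    M lam e hl0 hl1 (fun x hx => by linarith [hx.2.2.1])
    (fun x hx => by
      rw [div_le_iff₀ (by linarith [hx.2.2.1])]
      exact chord_le hf _ hx.2.2.1.le) J (0, 0, b0)
    ⟨⟨le_rfl, zero_le_one⟩, le_rfl, hb00, hb1⟩ (by
      have : 0 ≤ chord f 0 0 b0 / (b0 - 0) :=
        div_nonneg (chord_nonneg _ _ _ _) (by linarith)
      simp only
      linarith)
  simp only at ht0 ht1 ha hab hb hR hℓ hmax
  obtain ⟨ℓ, hℓe⟩ : ∃ ℓ, ℓ = b - a := ⟨_, rfl⟩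
  have hℓ0 : 0 < ℓ := by linarith
  have hℓ1 : ℓ ≤ 1 := by linarith
  obtain ⟨R, hRe⟩ : ∃ R, R = chord f t a b / (b - a) := ⟨_, rfl⟩
  rw [← hRe] at hR hmax
  rw [← hℓe] at hℓ hmax hRe
  have hRℓ : chord f t a b = R * ℓ := by rw [hRe]; field_simp
  have hcR : c ≤ R := by
    refine le_trans ?_ hR
    rw [sub_zero, le_div_iff₀ hb00]; exact hb2
  have hRM : R ≤ M := by
    rw [hRe, div_le_iff₀ hℓ0, hℓe]; exact chord_le hf _ hab.le
  obtain ⟨L, hL⟩ : ∃ L, L = R + e := ⟨_, rfl⟩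
  have hL0 : 0 ≤ L := by linarith
  have hL2 : L ≤ 2 * M := by linarith
  have hL3 : 1 ≤ 2 * M ^ 3 * L := by
    have : c ≤ L := by linarith
    have := mul_le_mul_of_nonneg_right this (show 0 ≤ 2 * M ^ 3 by positivity)
    linarith
  obtain ⟨ρ, hρe⟩ : ∃ ρ, ρ = ℓ / (n * K) := ⟨_, rfl⟩
  have hρ0 : 0 < ρ := by rw [hρe]; positivity
  have hρn : n * (K * ρ) = ℓ := by rw [hρe]; field_simp
  have hρs : ρ ≤ 1 / 2000 := by
    rw [hρe, div_le_iff₀ (by positivity)]; linarith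
  have hρsq : ρ ^ 2 ≤ 1 / 2 := by nlinarith
  have hlamℓ : lam * ℓ = σ * ρ := by rw [hlam, hρe]; ring
  have hKρ : 0 < K * ρ := by positivity
  have hchord : ∀ t' ∈ Set.Icc (0 : ℝ) 1, ∀ a' b', a ≤ a' → b' ≤ b → σ * ρ ≤ b' - a' →
      chord f t' a' b' ≤ L * (b' - a') := by
    intro t' ht' a' b' h1 h2 h3
    have hσρ : 0 < σ * ρ := by positivity
    have := hmax (t', a', b') ⟨ht', ha.trans h1, sub_pos.mp (lt_of_lt_of_le hσρ h3),
      h2.trans hb⟩ (hlamℓ.le.trans h3)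
    simp only at this
    rw [div_le_iff₀ (lt_of_lt_of_le hσρ h3)] at this
    rw [hL]; exact this
  obtain ⟨φ, hφ⟩ := exists_angle ((f (b, t)).1 - (f (a, t)).1) ((f (b, t)).2.1 - (f (a, t)).2.1)
  have hYab : Yf f φ (b, t) - Yf f φ (a, t) = R * ℓ := by
    rw [← hRℓ, chord, ← hφ]
    simp only [Yf, Rrot]; ring
  -- the sign
  obtain ⟨s, hs, hst⟩ : ∃ s : ℝ, |s| = 1 ∧ ∀ v ∈ Set.Icc (0 : ℝ) 1,
      t + s * ρ ^ 2 * v ∈ Set.Icc (0 : ℝ) 1 := by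
    have hq := sq_nonneg ρ
    rcases le_total t (1 / 2) with h | h
    · refine ⟨1, by simp, fun v hv => ⟨?_, ?_⟩⟩
      · have := mul_nonneg hq hv.1
        linarith
      · have := mul_le_mul_of_nonneg_left hv.2 hq
        linarith
    · refine ⟨-1, by simp, fun v hv => ⟨?_, ?_⟩⟩
      · have := mul_le_mul_of_nonneg_left hv.2 hq
        linarith
      · have := mul_nonneg hq hv.1
        linarith
  obtain ⟨t1, ht1e⟩ : ∃ t1, t1 = t + s * ρ ^ 2 * 1 := ⟨_, rfl⟩
  have ht1m : t1 ∈ Set.Icc (0 : ℝ) 1 := ht1e ▸ hst 1 ⟨zero_le_one, le_rfl⟩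
  have hvert : ∀ y, |Yf f φ (y, t1) - Yf f φ (y, t)| ≤ M * ρ := by
    intro y
    apply dH_Y
    rw [dH_rot]
    refine (hf _ _).2.trans (le_of_eq ?_)
    congr 1
    simp only [dPar, ht1e]
    rw [show t + s * ρ ^ 2 * 1 - t = s * ρ ^ 2 by ring, abs_mul, hs, one_mul,
      abs_of_nonneg (sq_nonneg ρ), Real.sqrt_sq hρ0.le, sub_self, abs_zero]
    exact max_eq_right hρ0.le
  -- pigeonhole
  obtain ⟨i, hi, hD⟩ := pigeon (fun i => 2 * (L * (K * ρ) * i) -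
    (Yf f φ (a + i * (K * ρ), t) + Yf f φ (a + i * (K * ρ), t1))) n (η * ρ) hnN (by
      have hvb := abs_le.mp (hvert b)
      have hva := abs_le.mp (hvert a)
      have e1 : a + n * (K * ρ) = b := by rw [hρn, hℓe]; ring
      have e2 : L * (K * ρ) * n = L * ℓ := by rw [← hρn]; ring
      simp only [Nat.cast_zero, zero_mul, add_zero, mul_zero]
      rw [e1, e2]
      have e3 : L * ℓ = R * ℓ + e * ℓ := by rw [hL]; ring
      have e4 : e * ℓ = n * ρ * η / 4 := by rw [← hρn, ← heK]; ring
      have e5 : 4 * M * ρ ≤ n * η * ρ := mul_le_mul_of_nonneg_right hn' hρ0.le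
      linarith [hYab, hvb.1, hva.2])
  have hi' : (i : ℝ) + 1 ≤ n := by exact_mod_cast hi
  have hi0 : (0 : ℝ) ≤ i := Nat.cast_nonneg i
  obtain ⟨y0, hy0⟩ : ∃ y0, y0 = a + i * (K * ρ) := ⟨_, rfl⟩
  have hay : a ≤ y0 := by rw [hy0]; nlinarith
  have hyb : y0 + K * ρ ≤ b := by
    have := mul_le_mul_of_nonneg_right hi' hKρ.le
    rw [hy0]; linarith
  push_cast at hD
  rw [show a + ((i : ℝ) + 1) * (K * ρ) = y0 + K * ρ by rw [hy0]; ring, ← hy0] at hD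
  have hσK : σ * ρ ≤ K * ρ := mul_le_mul_of_nonneg_right (by linarith) hρ0.le
  have hi0 := (Yf_le_chord f φ t y0 (y0 + K * ρ)).trans
    (hchord t ⟨ht0, ht1⟩ y0 (y0 + K * ρ) hay hyb (by linarith))
  have hi1 := (Yf_le_chord f φ t1 y0 (y0 + K * ρ)).trans
    (hchord t1 ht1m y0 (y0 + K * ρ) hay hyb (by linarith))
  rw [add_sub_cancel_left] at hi0 hi1
  have hst0 := line_straight hM hf (y0, t) φ hρ0 hs 0 t (by simp) K L ξ η σ ε (by linarith) hL0 hL2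
    hξ0 hη0.le hσ0 (by linarith) h8 h9 h10
    (fun a' b' h1 h2 h3 => hchord t ⟨ht0, ht1⟩ a' b' (hay.trans h1) (le_trans h2 hyb) h3)
    (by simp only; linarith)
  have hst1 := line_straight hM hf (y0, t) φ hρ0 hs 1 t1 ht1e K L ξ η σ ε (by linarith) hL0 hL2
    hξ0 hη0.le hσ0 (by linarith) h8 h9 h10
    (fun a' b' h1 h2 h3 => hchord t1 ht1m a' b' (hay.trans h1) (le_trans h2 hyb) h3)
    (by simp only; linarith)
  have hg0 : resc f (y0, t) ρ s φ (0, 0) = (0, 0, 0) := by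
    simp only [resc, rescW, mul_zero, add_zero, Hmul, Hinv, Rrot, dil]
    refine Prod.ext ?_ (Prod.ext ?_ ?_) <;> simp only <;> ring
  have hmul0 : ∀ p : Hei, Hmul (Hinv (0, 0, 0)) p = p := by
    intro p
    simp only [Hmul, Hinv]
    refine Prod.ext ?_ (Prod.ext ?_ ?_) <;> simp only <;> ring
  rw [hg0] at hst0
  simp only [hmul0] at hst0
  obtain ⟨v0, hcore⟩ := core (resc f (y0, t) ρ s φ) M L K ε hM (resc_bilip hf _ φ hρ0 hs) hL3 hK
    hε0 hε hg0 hst0 hst1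
  have hbox : HasBox 0 (resc f (y0, t) ρ s φ '' (Set.Icc 0 (8 * M ^ 4) ×ˢ Set.Icc 0 1)) 1
      (1 / (8 * M ^ 2)) := by
    refine ⟨M + 1 / 2, v0, 0, fun u hu v hv => ?_⟩
    obtain ⟨x, hx, y, hy, e1, e2⟩ := hcore u ⟨hu.1, by linarith [hu.2]⟩ v hv
    refine ⟨_, ⟨(x, y), ⟨hx, hy⟩, rfl⟩, ?_⟩
    have : ∀ p : Hei, Rrot (-0) p = p := by
      intro p; simp [Rrot]
    rw [this, zero_mul, add_zero]
    exact ⟨e1, e2⟩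
  refine ⟨0 + φ, ρ, ?_, hasBox_resc (y0, t) φ 0 hρ0 ?_ hbox⟩
  · rw [hρe]
    apply div_le_div_of_nonneg_right _ (by positivity)
    refine le_trans ?_ hℓ
    rw [sub_zero]
    exact mul_le_mul_of_nonneg_left hb0 (by positivity)
  · rintro ⟨x, y⟩ ⟨hx, hy⟩
    simp only at hx hy
    refine ⟨?_, hst y hy⟩
    simp only [rescW]
    constructor
    · have := mul_nonneg hρ0.le hx.1
      linarith
    · have := mul_le_mul_of_nonneg_left (hx.2.trans hKM) hρ0.le
      linarith

/-- **Proposition 4.1.** Rickman rugs have big vertical projections. -/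
theorem rug_has_big_vertical_projections :
    ∀ M : ℝ, 1 ≤ M → ∃ δ > (0 : ℝ),
      ∀ f : ℝ × ℝ → Hei, IsBilipschitz M f →
        ∀ w : ℝ × ℝ, ∀ r > (0 : ℝ),
          ∃ θ ∈ Set.Ico (-(Real.pi / 2)) (Real.pi / 2),
            ENNReal.ofReal (δ * r ^ 3) ≤ H3 (PiTheta θ '' (f '' BPar w r)) := by
  intro M hM
  obtain ⟨ρ0, hρ0, hbox⟩ := box_exists M hM
  have hM0 : 0 < M := by linarith
  refine ⟨ρ0 ^ 3 / (8 * M ^ 2), by positivity, ?_⟩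
  intro f hf w r hr
  obtain ⟨θ, ρ, hρ, hb⟩ := hbox _ (resc_bilip hf w 0 hr (s := 1) abs_one)
  have hb2 := hasBox_resc (T := BPar w r) w 0 θ hr (by
    rintro ⟨x, y⟩ ⟨hx, hy⟩
    simp only at hx hy
    simp only [rescW, BPar, dPar, Set.mem_ofPred_eq, add_sub_cancel_left, one_mul]
    have hx0 := hx.1
    have hx1 := hx.2
    have hy0 := hy.1
    have hy1 := hy.2
    apply max_le
    · rw [abs_of_nonneg (mul_nonneg hr.le hx0)]
      nlinarith
    · rw [abs_of_nonneg (mul_nonneg (sq_nonneg r) hy0)]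
      apply Real.sqrt_le_iff.mpr ⟨hr.le, ?_⟩
      nlinarith [sq_nonneg r]) hb
  have hρp : 0 < ρ := lt_of_lt_of_le hρ0 hρ
  have h3 := hasBox_H3 (by positivity) hb2
  obtain ⟨θ', hθ', heq⟩ := PiTheta_mod (θ + 0)
  refine ⟨θ', hθ', ?_⟩
  rw [heq]
  refine le_trans (ENNReal.ofReal_le_ofReal ?_) h3
  have : ρ0 ^ 3 ≤ ρ ^ 3 := pow_le_pow_left₀ hρ0.le hρ 3
  calc ρ0 ^ 3 / (8 * M ^ 2) * r ^ 3 ≤ ρ ^ 3 / (8 * M ^ 2) * r ^ 3 := by gcongr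
    _ = _ := by ring

end HeisRug
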